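/- Let B be a noetherian scheme, let S be a finite type B-scheme, and let X and Y be finite type S-schemes. Then there exist a scheme A of finite type over Spec ℤ, a morphism B → A, a finite type A-scheme S_A, finite type S_A-schemes X_A and Y_A, and isomorphisms of B-schemes S_A ×_A B ≅ S, X_A ×_A B ≅ X, Y_A ×_A B ≅ Y which are compatible with the structure morphisms; that is, the base change of the diagram X_A → S_A ← Y_A along B → A is isomorphic to the diagram X → S ← Y. -/

import Mathlib

open AlgebraicGeometry CategoryTheory Limits

namespace ModelProof

/-- `P` is the gluing of `U` and `V` along the open subscheme `W`. -/
structure IsGlue {W U V P : Scheme.{0}} (w₁ : W ⟶ U) (w₂ : W ⟶ V) (j₁ : U ⟶ P) (j₂ : V ⟶ P) :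
    Prop where
  o₁ : IsOpenImmersion j₁
  o₂ : IsOpenImmersion j₂
  pb : IsPullback w₁ w₂ j₁ j₂
  cov : ∀ p : P, (∃ u, j₁ u = p) ∨ (∃ v, j₂ v = p)

/-- The two element open cover given by two jointly surjective open immersions. -/
noncomputable def cover2 {U V P : Scheme.{0}} (j₁ : U ⟶ P) (j₂ : V ⟶ P)
    [o₁ : IsOpenImmersion j₁] [o₂ : IsOpenImmersion j₂]
    (cov : ∀ p : P, (∃ u, j₁ u = p) ∨ (∃ v, j₂ v = p)) : P.OpenCover :=
  Scheme.Cover.mkOfCovers Bool (fun b => Bool.rec V U b)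
    (fun b => Bool.rec j₂ j₁ b)
    (fun p => by
      rcases cov p with ⟨u, h⟩ | ⟨v, h⟩
      · exact ⟨true, u, h⟩
      · exact ⟨false, v, h⟩)
    (fun b => by cases b; exacts [o₂, o₁])

theorem hom_ext2 {U V P : Scheme.{0}} (j₁ : U ⟶ P) (j₂ : V ⟶ P)
    [o₁ : IsOpenImmersion j₁] [o₂ : IsOpenImmersion j₂]
    (cov : ∀ p : P, (∃ u, j₁ u = p) ∨ (∃ v, j₂ v = p)) {T : Scheme.{0}} (a b : P ⟶ T)
    (h₁ : j₁ ≫ a = j₁ ≫ b) (h₂ : j₂ ≫ a = j₂ ≫ b) : a = b := by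
  refine (cover2 j₁ j₂ cov).hom_ext _ _ ?_
  intro i
  cases i
  · exact h₂
  · exact h₁

namespace IsGlue

variable {W U V P : Scheme.{0}} {w₁ : W ⟶ U} {w₂ : W ⟶ V} {j₁ : U ⟶ P} {j₂ : V ⟶ P}

theorem exists_desc (h : IsGlue w₁ w₂ j₁ j₂) {T : Scheme.{0}} (a : U ⟶ T) (b : V ⟶ T)
    (hab : w₁ ≫ a = w₂ ≫ b) : ∃ l : P ⟶ T, j₁ ≫ l = a ∧ j₂ ≫ l = b := by
  have := h.o₁
  have := h.o₂
  have key : pullback.fst j₁ j₂ ≫ a = pullback.snd j₁ j₂ ≫ b := by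
    rw [← cancel_epi h.pb.isoPullback.hom]
    simpa using hab
  have key' : pullback.fst j₂ j₁ ≫ b = pullback.snd j₂ j₁ ≫ a := by
    rw [← cancel_epi (pullbackSymmetry j₁ j₂).hom]
    simpa using key.symm
  let F : ∀ x : (cover2 j₁ j₂ h.cov).I₀, (cover2 j₁ j₂ h.cov).X x ⟶ T :=
    fun x => Bool.rec b a x
  have hF : ∀ x y, pullback.fst ((cover2 j₁ j₂ h.cov).f x) ((cover2 j₁ j₂ h.cov).f y) ≫ F x =
      pullback.snd _ _ ≫ F y := by
    intro x y
    cases x <;> cases y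
    · change pullback.fst j₂ j₂ ≫ b = pullback.snd j₂ j₂ ≫ b
      rw [fst_eq_snd_of_mono_eq]
    · exact key'
    · exact key
    · change pullback.fst j₁ j₁ ≫ a = pullback.snd j₁ j₁ ≫ a
      rw [fst_eq_snd_of_mono_eq]
  exact ⟨(cover2 j₁ j₂ h.cov).glueMorphisms F hF,
    (cover2 j₁ j₂ h.cov).ι_glueMorphisms F hF true,
    (cover2 j₁ j₂ h.cov).ι_glueMorphisms F hF false⟩

theorem hom_ext (h : IsGlue w₁ w₂ j₁ j₂) {T : Scheme.{0}} {a b : P ⟶ T}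
    (h₁ : j₁ ≫ a = j₁ ≫ b) (h₂ : j₂ ≫ a = j₂ ≫ b) : a = b :=
  have := h.o₁
  have := h.o₂
  hom_ext2 j₁ j₂ h.cov a b h₁ h₂

theorem w (h : IsGlue w₁ w₂ j₁ j₂) : w₁ ≫ j₁ = w₂ ≫ j₂ := h.pb.w

/-- the induced morphism -/
noncomputable def desc (h : IsGlue w₁ w₂ j₁ j₂) {T : Scheme.{0}} (a : U ⟶ T) (b : V ⟶ T)
    (hab : w₁ ≫ a = w₂ ≫ b) : P ⟶ T := (h.exists_desc a b hab).choose

@[simp]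
theorem inl_desc (h : IsGlue w₁ w₂ j₁ j₂) {T : Scheme.{0}} (a : U ⟶ T) (b : V ⟶ T)
    (hab : w₁ ≫ a = w₂ ≫ b) : j₁ ≫ h.desc a b hab = a := (h.exists_desc a b hab).choose_spec.1

@[simp]
theorem inr_desc (h : IsGlue w₁ w₂ j₁ j₂) {T : Scheme.{0}} (a : U ⟶ T) (b : V ⟶ T)
    (hab : w₁ ≫ a = w₂ ≫ b) : j₂ ≫ h.desc a b hab = b := (h.exists_desc a b hab).choose_spec.2

@[simp]
theorem inl_desc_assoc (h : IsGlue w₁ w₂ j₁ j₂) {T Z : Scheme.{0}} (a : U ⟶ T) (b : V ⟶ T)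
    (hab : w₁ ≫ a = w₂ ≫ b) (z : T ⟶ Z) : j₁ ≫ h.desc a b hab ≫ z = a ≫ z := by
  rw [← Category.assoc, inl_desc]

@[simp]
theorem inr_desc_assoc (h : IsGlue w₁ w₂ j₁ j₂) {T Z : Scheme.{0}} (a : U ⟶ T) (b : V ⟶ T)
    (hab : w₁ ≫ a = w₂ ≫ b) (z : T ⟶ Z) : j₂ ≫ h.desc a b hab ≫ z = b ≫ z := by
  rw [← Category.assoc, inr_desc]

theorem symm (h : IsGlue w₁ w₂ j₁ j₂) : IsGlue w₂ w₁ j₂ j₁ :=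
  ⟨h.o₂, h.o₁, h.pb.flip, fun p => (h.cov p).symm⟩

end IsGlue

theorem span_map_isOpenImmersion {W U V : Scheme.{0}} (w₁ : W ⟶ U) (w₂ : W ⟶ V)
    [h₁ : IsOpenImmersion w₁] [h₂ : IsOpenImmersion w₂] {i j : WalkingSpan} (f : i ⟶ j) :
    IsOpenImmersion ((span w₁ w₂).map f) := by
  match i, j, f with
  | _, _, .id _ =>
    erw [CategoryTheory.Functor.map_id]; infer_instance
  | _, _, .init .left => exact h₁
  | _, _, .init .right => exact h₂

theorem exists_isGlue {W U V : Scheme.{0}} (w₁ : W ⟶ U) (w₂ : W ⟶ V)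
    [IsOpenImmersion w₁] [IsOpenImmersion w₂] :
    ∃ (P : Scheme.{0}) (j₁ : U ⟶ P) (j₂ : V ⟶ P), IsGlue w₁ w₂ j₁ j₂ := by
  have hs : ∀ {i j : WalkingSpan} (f : i ⟶ j), IsOpenImmersion ((span w₁ w₂).map f) :=
    fun f => span_map_isOpenImmersion w₁ w₂ f
  have hld : ((span w₁ w₂) ⋙ Scheme.forget).IsLocallyDirected := by
    have := @hs
    exact inferInstanceAs (((span w₁ w₂ : WidePushoutShape WalkingPair ⥤ Scheme.{0}) ⋙ Scheme.forget).IsLocallyDirected)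
  have : HasColimit (span w₁ w₂) := inferInstance
  let P := colimit (span w₁ w₂)
  let j₁ : U ⟶ P := colimit.ι (span w₁ w₂) WalkingSpan.left
  let j₂ : V ⟶ P := colimit.ι (span w₁ w₂) WalkingSpan.right
  have o₁ : IsOpenImmersion j₁ :=
    Scheme.IsLocallyDirected.instIsOpenImmersionι (span w₁ w₂) WalkingSpan.left
  have o₂ : IsOpenImmersion j₂ :=
    Scheme.IsLocallyDirected.instIsOpenImmersionι (span w₁ w₂) WalkingSpan.right
  have e₁ : w₁ ≫ j₁ = colimit.ι (span w₁ w₂) WalkingSpan.zero :=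
    colimit.w (span w₁ w₂) WalkingSpan.Hom.fst
  have e₂ : w₂ ≫ j₂ = colimit.ι (span w₁ w₂) WalkingSpan.zero :=
    colimit.w (span w₁ w₂) WalkingSpan.Hom.snd
  have c₁ : ∀ x : W, j₁ (w₁ x) = (show W ⟶ P from colimit.ι (span w₁ w₂) WalkingSpan.zero) x := by
    intro x
    rw [← Scheme.Hom.comp_apply, e₁]
  refine ⟨P, j₁, j₂, o₁, o₂, ?_, ?_⟩
  · apply IsOpenImmersion.isPullback
    · rw [e₁, e₂]
    · ext x
      constructor
      · rintro ⟨u, hu⟩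
        obtain ⟨k, fi, fj, z, h1, h2⟩ := (Scheme.IsLocallyDirected.ι_eq_ι_iff (span w₁ w₂)
          (i := WalkingSpan.left) (j := WalkingSpan.right) (xi := u) (xj := x)).mp hu
        match k, fi, fj, z, h1, h2 with
        | .none, .init _, .init _, z, h1, h2 => exact ⟨z, h2⟩
      · rintro ⟨z, rfl⟩
        refine ⟨w₁ z, ?_⟩
        change j₁ (w₁ z) = j₂ (w₂ z)
        rw [← Scheme.Hom.comp_apply, ← Scheme.Hom.comp_apply, e₁, e₂]
  · intro p
    obtain ⟨i, x, hx⟩ := Scheme.IsLocallyDirected.ι_jointly_surjective (span w₁ w₂) p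
    match i, x, hx with
    | .none, x, hx =>
      left
      refine ⟨w₁ x, ?_⟩
      exact (c₁ x).trans hx
    | .left, x, hx => exact Or.inl ⟨x, hx⟩
    | .right, x, hx => exact Or.inr ⟨x, hx⟩

end ModelProof

namespace ModelProof

theorem exists_point_of_isPullback {P X Y Z : Scheme.{0}} {fst : P ⟶ X} {snd : P ⟶ Y} {f : X ⟶ Z}
    {g : Y ⟶ Z} (h : IsPullback fst snd f g) (x : X) (y : Y) (e : f x = g y) :
    ∃ p : P, fst p = x ∧ snd p = y := by
  obtain ⟨z, h1, h2⟩ := Scheme.Pullback.exists_preimage_pullback x y e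
  refine ⟨h.isoPullback.inv z, ?_, ?_⟩
  · rw [← Scheme.Hom.comp_apply, h.isoPullback_inv_fst, h1]
  · rw [← Scheme.Hom.comp_apply, h.isoPullback_inv_snd, h2]

namespace IsGlue

variable {W U V P : Scheme.{0}} {w₁ : W ⟶ U} {w₂ : W ⟶ V} {j₁ : U ⟶ P} {j₂ : V ⟶ P}

theorem isOpenImmersion_left (h : IsGlue w₁ w₂ j₁ j₂) : IsOpenImmersion w₁ :=
  have := h.o₂
  MorphismProperty.of_isPullback h.pb.flip this

theorem isOpenImmersion_right (h : IsGlue w₁ w₂ j₁ j₂) : IsOpenImmersion w₂ :=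
  h.symm.isOpenImmersion_left

variable {W' U' V' P' : Scheme.{0}} {w₁' : W' ⟶ U'} {w₂' : W' ⟶ V'} {j₁' : U' ⟶ P'} {j₂' : V' ⟶ P'}

/-- `U` is the preimage of `U'` when `W` is the preimage of `W'` in `V`. -/
theorem isPullback_left (h : IsGlue w₁ w₂ j₁ j₂) (h' : IsGlue w₁' w₂' j₁' j₂')
    {u : U ⟶ U'} {v : V ⟶ V'} {t : W ⟶ W'} {m : P ⟶ P'}
    (pV : IsPullback t w₂ w₂' v)
    (hm₁ : j₁ ≫ m = u ≫ j₁') (hm₂ : j₂ ≫ m = v ≫ j₂') : IsPullback u j₁ j₁' m := by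
  have := h.o₁
  have := h'.o₁
  refine IsOpenImmersion.isPullback _ _ _ _ hm₁ ?_
  ext p
  constructor
  · rintro ⟨u', hu'⟩
    rcases h.cov p with ⟨x, rfl⟩ | ⟨y, rfl⟩
    · exact ⟨x, rfl⟩
    · have e : j₁' u' = j₂' (v y) := by
        rw [← Scheme.Hom.comp_apply, ← hm₂]
        exact hu'
      obtain ⟨q, hq1, hq2⟩ := exists_point_of_isPullback h'.pb _ _ e
      obtain ⟨z, hz1, hz2⟩ := exists_point_of_isPullback pV _ _ hq2
      refine ⟨w₁ z, ?_⟩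
      rw [← hz2, ← Scheme.Hom.comp_apply, ← Scheme.Hom.comp_apply, h.w]
  · rintro ⟨x, rfl⟩
    refine ⟨u x, ?_⟩
    rw [← Scheme.Hom.comp_apply, ← Scheme.Hom.comp_apply, hm₁]

theorem isPullback_right (h : IsGlue w₁ w₂ j₁ j₂) (h' : IsGlue w₁' w₂' j₁' j₂')
    {u : U ⟶ U'} {v : V ⟶ V'} {t : W ⟶ W'} {m : P ⟶ P'}
    (pU : IsPullback t w₁ w₁' u)
    (hm₁ : j₁ ≫ m = u ≫ j₁') (hm₂ : j₂ ≫ m = v ≫ j₂') : IsPullback v j₂ j₂' m :=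
  h.symm.isPullback_left h'.symm pU hm₂ hm₁

/-- Properties local at the target can be checked on the glue pieces. -/
theorem of_target (Q : MorphismProperty Scheme.{0}) [IsZariskiLocalAtTarget Q]
    (h' : IsGlue w₁' w₂' j₁' j₂') {u : U ⟶ U'} {v : V ⟶ V'} {m : P ⟶ P'}
    (p₁ : IsPullback u j₁ j₁' m) (p₂ : IsPullback v j₂ j₂' m) (hu : Q u) (hv : Q v) : Q m := by
  have := h'.o₁
  have := h'.o₂
  refine IsZariskiLocalAtTarget.of_openCover (cover2 j₁' j₂' h'.cov) ?_
  intro i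
  cases i
  · have : Q (pullback.snd m j₂') := by
      have e : p₂.flip.isoPullback.hom ≫ pullback.snd m j₂' = v := by simp
      exact (Q.cancel_left_of_respectsIso p₂.flip.isoPullback.hom _).mp (by rw [e]; exact hv)
    exact this
  · have : Q (pullback.snd m j₁') := by
      have e : p₁.flip.isoPullback.hom ≫ pullback.snd m j₁' = u := by simp
      exact (Q.cancel_left_of_respectsIso p₁.flip.isoPullback.hom _).mp (by rw [e]; exact hu)
    exact this

theorem of_source (Q : MorphismProperty Scheme.{0}) [IsZariskiLocalAtSource Q]
    (h : IsGlue w₁ w₂ j₁ j₂) {T : Scheme.{0}} (m : P ⟶ T)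
    (hu : Q (j₁ ≫ m)) (hv : Q (j₂ ≫ m)) : Q m := by
  have := h.o₁
  have := h.o₂
  refine (IsZariskiLocalAtSource.iff_of_openCover (cover2 j₁ j₂ h.cov)).mpr ?_
  intro i
  cases i
  · exact hv
  · exact hu

theorem compactSpace (h : IsGlue w₁ w₂ j₁ j₂) [CompactSpace U] [CompactSpace V] :
    CompactSpace P := by
  rw [← isCompact_univ_iff]
  have : (Set.univ : Set P) = Set.range j₁ ∪ Set.range j₂ := by
    ext p
    simpa using h.cov p
  rw [this]
  exact (isCompact_range j₁.continuous).union (isCompact_range j₂.continuous)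

theorem quasiSeparatedSpace (h : IsGlue w₁ w₂ j₁ j₂) [CompactSpace W] [QuasiSeparatedSpace U]
    [QuasiSeparatedSpace V] : QuasiSeparatedSpace P := by
  have := h.o₁
  have := h.o₂
  have q₁ : IsQuasiSeparated (j₁.opensRange : Set P) := by
    rw [← Set.image_univ.trans (Scheme.Hom.coe_opensRange j₁).symm]
    exact (isQuasiSeparated_univ_iff.mpr inferInstance).image_of_isEmbedding
      j₁.isOpenEmbedding.isEmbedding
  have q₂ : IsQuasiSeparated (j₂.opensRange : Set P) := by
    rw [← Set.image_univ.trans (Scheme.Hom.coe_opensRange j₂).symm]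
    exact (isQuasiSeparated_univ_iff.mpr inferInstance).image_of_isEmbedding
      j₂.isOpenEmbedding.isEmbedding
  have hC : ((j₁.opensRange ⊓ j₂.opensRange : P.Opens) : Set P) = Set.range (w₁ ≫ j₁) := by
    ext p
    constructor
    · rintro ⟨⟨a, ha⟩, ⟨b, hb⟩⟩
      obtain ⟨q, hq1, hq2⟩ := exists_point_of_isPullback h.pb a b (ha.trans hb.symm)
      exact ⟨q, by rw [Scheme.Hom.comp_apply, hq1, ha]⟩
    · rintro ⟨z, rfl⟩
      refine ⟨⟨w₁ z, (Scheme.Hom.comp_apply ..).symm⟩, ⟨w₂ z, ?_⟩⟩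
      rw [h.w]
      exact (Scheme.Hom.comp_apply ..).symm
  have kC : IsCompact ((j₁.opensRange ⊓ j₂.opensRange : P.Opens) : Set P) := by
    rw [hC]
    exact isCompact_range (w₁ ≫ j₁).continuous
  set R₁ := j₁.opensRange
  set R₂ := j₂.opensRange
  have mixed : ∀ O O' : P.affineOpens, O.1 ≤ R₁ → O'.1 ≤ R₂ →
      IsCompact ((O.1 : Set P) ∩ (O'.1 : Set P)) := by
    intro O O' hO hO'
    have k1 := q₁ O.1 (R₁ ⊓ R₂ : P.Opens) hO O.1.2 O.2.isCompact (fun x hx => hx.1)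
      (R₁ ⊓ R₂).2 kC
    have k2 := q₂ O'.1 (R₁ ⊓ R₂ : P.Opens) hO' O'.1.2 O'.2.isCompact (fun x hx => hx.2)
      (R₁ ⊓ R₂).2 kC
    have k3 := q₁ _ _ (fun x hx => hO hx.1) (O.1.2.inter (R₁ ⊓ R₂).2) k1
      (fun x hx => hx.2.1) (O'.1.2.inter (R₁ ⊓ R₂).2) k2
    convert k3 using 1
    ext x
    constructor
    · rintro ⟨a, b⟩
      exact ⟨⟨a, hO a, hO' b⟩, ⟨b, hO a, hO' b⟩⟩
    · rintro ⟨⟨a, _⟩, ⟨b, _⟩⟩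
      exact ⟨a, b⟩
  refine Scheme.quasiSeparatedSpace_of_isOpenCover
    (fun O : {O : P.affineOpens // O.1 ≤ R₁ ∨ O.1 ≤ R₂} => O.1.1) ?_ (fun O => O.1.2) ?_
  · rw [TopologicalSpace.IsOpenCover, eq_top_iff]
    intro p _
    have key : ∀ R : P.Opens, p ∈ R → ∃ O : P.affineOpens, p ∈ O.1 ∧ O.1 ≤ R := by
      intro R hR
      obtain ⟨O, hO, hp, hle⟩ := P.isBasis_affineOpens.exists_subset_of_mem_open hR R.2
      obtain ⟨O', hO', rfl⟩ := hO
      exact ⟨⟨O', hO'⟩, hp, hle⟩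
    rw [TopologicalSpace.Opens.mem_iSup]
    rcases h.cov p with hp | hp
    · obtain ⟨O, h1, h2⟩ := key R₁ hp
      exact ⟨⟨O, Or.inl h2⟩, h1⟩
    · obtain ⟨O, h1, h2⟩ := key R₂ hp
      exact ⟨⟨O, Or.inr h2⟩, h1⟩
  · rintro ⟨O, hO⟩ ⟨O', hO'⟩
    rcases hO with hO | hO <;> rcases hO' with hO' | hO'
    · exact q₁ _ _ hO O.1.2 O.2.isCompact hO' O'.1.2 O'.2.isCompact
    · exact mixed O O' hO hO'
    · rw [Set.inter_comm]; exact mixed O' O hO' hO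
    · exact q₂ _ _ hO O.1.2 O.2.isCompact hO' O'.1.2 O'.2.isCompact

end IsGlue

/-- two opens covering `X` form a glue -/
theorem isGlue_opens {X : Scheme.{0}} (U V : X.Opens) (h : U ⊔ V = ⊤) :
    IsGlue (X.homOfLE (inf_le_left : U ⊓ V ≤ U)) (X.homOfLE (inf_le_right : U ⊓ V ≤ V))
      U.ι V.ι :=
  ⟨inferInstance, inferInstance, isPullback_opens_inf U V, fun p => by
    have : p ∈ U ⊔ V := by rw [h]; trivial
    rcases this with hp | hp
    · exact Or.inl ⟨⟨p, hp⟩, rfl⟩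
    · exact Or.inr ⟨⟨p, hp⟩, rfl⟩⟩

end ModelProof

namespace ModelProof

namespace IsGlue

variable {W U V P : Scheme.{0}} {w₁ : W ⟶ U} {w₂ : W ⟶ V} {j₁ : U ⟶ P} {j₂ : V ⟶ P}
variable {W' U' V' P' : Scheme.{0}} {w₁' : W' ⟶ U'} {w₂' : W' ⟶ V'} {j₁' : U' ⟶ P'} {j₂' : V' ⟶ P'}

theorem isPullback_base_aux (h' : IsGlue w₁' w₂' j₁' j₂')
    {u : U ⟶ U'} {v : V ⟶ V'} {m : P ⟶ P'}
    (p₁ : IsPullback u j₁ j₁' m) (p₂ : IsPullback v j₂ j₂' m)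
    {C D : Scheme.{0}} {π : C ⟶ D} {c : P ⟶ C} {d : P' ⟶ D}
    (hU : IsPullback u (j₁ ≫ c) (j₁' ≫ d) π) (hV : IsPullback v (j₂ ≫ c) (j₂' ≫ d) π) :
    IsPullback m c d π := by
  have := h'.o₁
  have := h'.o₂
  refine Scheme.isPullback_of_openCover _ _ _ _ (cover2 j₁' j₂' h'.cov) ?_
  intro i
  cases i
  · change IsPullback (pullback.snd m j₂') (pullback.fst m j₂' ≫ c) (j₂' ≫ d) π
    refine IsPullback.of_iso hV p₂.flip.isoPullback (Iso.refl _) (Iso.refl _) (Iso.refl _)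
      ?_ ?_ ?_ ?_ <;> simp
  · change IsPullback (pullback.snd m j₁') (pullback.fst m j₁' ≫ c) (j₁' ≫ d) π
    refine IsPullback.of_iso hU p₁.flip.isoPullback (Iso.refl _) (Iso.refl _) (Iso.refl _)
      ?_ ?_ ?_ ?_ <;> simp

/-- A glue of cartesian squares over a base is cartesian. -/
theorem isPullback_base (h : IsGlue w₁ w₂ j₁ j₂) (h' : IsGlue w₁' w₂' j₁' j₂')
    {u : U ⟶ U'} {v : V ⟶ V'} {t : W ⟶ W'} {m : P ⟶ P'}
    (pU : IsPullback t w₁ w₁' u) (pV : IsPullback t w₂ w₂' v)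
    (hm₁ : j₁ ≫ m = u ≫ j₁') (hm₂ : j₂ ≫ m = v ≫ j₂')
    {C D : Scheme.{0}} {π : C ⟶ D} {c : P ⟶ C} {d : P' ⟶ D}
    (hU : IsPullback u (j₁ ≫ c) (j₁' ≫ d) π) (hV : IsPullback v (j₂ ≫ c) (j₂' ≫ d) π) :
    IsPullback m c d π :=
  isPullback_base_aux h' (h.isPullback_left h' pV hm₁ hm₂) (h.isPullback_right h' pU hm₁ hm₂) hU hV

end IsGlue

theorem cover_hom_ext {P T Z : Scheme.{0}} (𝒰 : P.OpenCover) (q : T ⟶ P) {x y : T ⟶ Z}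
    (h : ∀ k, pullback.fst q (𝒰.f k) ≫ x = pullback.fst q (𝒰.f k) ≫ y) : x = y :=
  Scheme.Cover.hom_ext (𝒰.pullback₁ q) _ _ h

theorem cover_glue {P T Z : Scheme.{0}} (𝒰 : P.OpenCover) (q : T ⟶ P)
    (l : ∀ k, pullback q (𝒰.f k) ⟶ Z)
    (h : ∀ k k', pullback.fst (pullback.fst q (𝒰.f k)) (pullback.fst q (𝒰.f k')) ≫ l k =
      pullback.snd (pullback.fst q (𝒰.f k)) (pullback.fst q (𝒰.f k')) ≫ l k') :
    ∃ g : T ⟶ Z, ∀ k, pullback.fst q (𝒰.f k) ≫ g = l k :=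
  ⟨Scheme.Cover.glueMorphisms (𝒰.pullback₁ q) l h,
    fun k => Scheme.Cover.ι_glueMorphisms (𝒰.pullback₁ q) l h k⟩

section Local

variable {I : Type} [SmallCategory I] {D : I ⥤ Scheme.{0}} (c : Cone D) {P : Scheme.{0}}
  (δ : D ⟶ (Functor.const I).obj P) [Nonempty I]

theorem local_hom_ext (𝒰 : P.OpenCover)
    (F : 𝒰.I₀ → I ⥤ Scheme.{0}) (ι : ∀ k, F k ⟶ D) (b : ∀ k i, (F k).obj i ⟶ 𝒰.X k)
    (hF : ∀ k i, IsPullback (b k i) ((ι k).app i) (𝒰.f k) (δ.app i))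
    (ck : ∀ k, Cone (F k)) (hk : ∀ k, IsLimit (ck k)) (j : ∀ k, (ck k).pt ⟶ c.pt)
    (hj : ∀ k i, j k ≫ c.π.app i = (ck k).π.app i ≫ (ι k).app i)
    (hc : ∀ k i, IsPullback ((ck k).π.app i ≫ b k i) (j k) (𝒰.f k) (c.π.app i ≫ δ.app i))
    {T : Scheme.{0}} (x y : T ⟶ c.pt) (h : ∀ i, x ≫ c.π.app i = y ≫ c.π.app i) : x = y := by
  obtain ⟨i₀⟩ := ‹Nonempty I›
  let q : T ⟶ P := x ≫ c.π.app i₀ ≫ δ.app i₀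
  have hq : q = y ≫ c.π.app i₀ ≫ δ.app i₀ := by
    simp only [q, ← Category.assoc, h]
  refine cover_hom_ext 𝒰 q ?_
  intro k
  let x' : pullback q (𝒰.f k) ⟶ (ck k).pt := (hc k i₀).lift (pullback.snd _ _)
    (pullback.fst _ _ ≫ x) (by rw [← pullback.condition]; simp [q])
  let y' : pullback q (𝒰.f k) ⟶ (ck k).pt := (hc k i₀).lift (pullback.snd _ _)
    (pullback.fst _ _ ≫ y) (by rw [← pullback.condition]; simp [hq])
  have hx' : x' ≫ j k = pullback.fst q (𝒰.f k) ≫ x := (hc k i₀).lift_snd _ _ _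
  have hy' : y' ≫ j k = pullback.fst q (𝒰.f k) ≫ y := (hc k i₀).lift_snd _ _ _
  have hx₁ : x' ≫ (ck k).π.app i₀ ≫ b k i₀ = pullback.snd q (𝒰.f k) := (hc k i₀).lift_fst _ _ _
  have hy₁ : y' ≫ (ck k).π.app i₀ ≫ b k i₀ = pullback.snd q (𝒰.f k) := (hc k i₀).lift_fst _ _ _
  rw [← hx', ← hy']
  congr 1
  refine (hk k).hom_ext ?_
  intro i
  have hmono : Mono ((ι k).app i) :=
    (MorphismProperty.monomorphisms Scheme.{0}).of_isPullback (hF k i)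
      (inferInstanceAs (Mono (𝒰.f k)))
  rw [← cancel_mono ((ι k).app i)]
  rw [Category.assoc, Category.assoc, ← hj, ← Category.assoc, ← Category.assoc, hx', hy',
    Category.assoc, Category.assoc, h]

/-- Being a limit cone is local. -/
theorem local_isLimit (𝒰 : P.OpenCover)
    (F : 𝒰.I₀ → I ⥤ Scheme.{0}) (ι : ∀ k, F k ⟶ D) (b : ∀ k i, (F k).obj i ⟶ 𝒰.X k)
    (hF : ∀ k i, IsPullback (b k i) ((ι k).app i) (𝒰.f k) (δ.app i))
    (ck : ∀ k, Cone (F k)) (hk : ∀ k, IsLimit (ck k)) (j : ∀ k, (ck k).pt ⟶ c.pt)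
    (hj : ∀ k i, j k ≫ c.π.app i = (ck k).π.app i ≫ (ι k).app i)
    (hc : ∀ k i, IsPullback ((ck k).π.app i ≫ b k i) (j k) (𝒰.f k) (c.π.app i ≫ δ.app i))
    (hconn : ∀ (s : Cone D) (i i' : I), s.π.app i ≫ δ.app i = s.π.app i' ≫ δ.app i') :
    Nonempty (IsLimit c) := by
  have hext := fun {T} x y h => local_hom_ext c δ 𝒰 F ι b hF ck hk j hj hc (T := T) x y h
  have hmono : ∀ k i, Mono ((ι k).app i) := fun k i =>
    (MorphismProperty.monomorphisms Scheme.{0}).of_isPullback (hF k i)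
      (inferInstanceAs (Mono (𝒰.f k)))
  have hex : ∀ s : Cone D, ∃ l : s.pt ⟶ c.pt, ∀ i, l ≫ c.π.app i = s.π.app i := by
    intro s
    let i₀ : I := Classical.arbitrary I
    let q : s.pt ⟶ P := s.π.app i₀ ≫ δ.app i₀
    have hq : ∀ i, q = s.π.app i ≫ δ.app i := fun i => hconn s i₀ i
    let S : ∀ k, Cone (F k) := fun k =>
      { pt := pullback q (𝒰.f k)
        π :=
          { app := fun i => (hF k i).lift (pullback.snd _ _) (pullback.fst _ _ ≫ s.π.app i)
              (by rw [← pullback.condition, hq i, Category.assoc])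
            naturality := by
              intro i i' f
              have := hmono k i'
              rw [← cancel_mono ((ι k).app i')]
              simp only [Functor.const_obj_obj, Functor.const_obj_map, Category.id_comp,
                Category.assoc, IsPullback.lift_snd, NatTrans.naturality]
              rw [IsPullback.lift_snd_assoc, Category.assoc, s.w] } }
    have hS : ∀ k i, (S k).π.app i ≫ (ι k).app i = pullback.fst q (𝒰.f k) ≫ s.π.app i :=
      fun k i => (hF k i).lift_snd _ _ _
    let l : ∀ k, pullback q (𝒰.f k) ⟶ c.pt := fun k => (hk k).lift (S k) ≫ j k
    have hl : ∀ k i, l k ≫ c.π.app i = pullback.fst q (𝒰.f k) ≫ s.π.app i := by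
      intro k i
      simp only [l, Category.assoc, hj]
      rw [IsLimit.fac_assoc, hS]
    clear_value l
    obtain ⟨g, hg⟩ := cover_glue 𝒰 q l (by
      intro k k'
      apply hext
      intro i
      rw [Category.assoc, Category.assoc, hl, hl, pullback.condition_assoc])
    refine ⟨g, fun i => cover_hom_ext 𝒰 q fun k => ?_⟩
    rw [← Category.assoc, hg, hl]
  choose l hl using hex
  exact ⟨{ lift := l
           fac := fun s i => hl s i
           uniq := fun s m hm => hext _ _ (fun i => by rw [hl, hm]) }⟩

end Local

/-- constructor for cones -/
def mkCone {I : Type} [SmallCategory I] (D : I ⥤ Scheme.{0}) (B : Scheme.{0})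
    (b : ∀ i, B ⟶ D.obj i) (h : ∀ {i i' : I} (f : i ⟶ i'), b i ≫ D.map f = b i') : Cone D where
  pt := B
  π := { app := b, naturality := fun _ _ f => (Category.id_comp _).trans (h f).symm }

@[simp] theorem mkCone_pt {I : Type} [SmallCategory I] (D : I ⥤ Scheme.{0}) (B : Scheme.{0})
    (b : ∀ i, B ⟶ D.obj i) (h : ∀ {i i' : I} (f : i ⟶ i'), b i ≫ D.map f = b i') :
    (mkCone D B b h).pt = B := rfl

/-- constructor for maps to constant functors -/
def mkConst {I : Type} [SmallCategory I] (D : I ⥤ Scheme.{0}) (B : Scheme.{0})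
    (b : ∀ i, D.obj i ⟶ B) (h : ∀ {i i' : I} (f : i ⟶ i'), D.map f ≫ b i' = b i) :
    D ⟶ (Functor.const I).obj B where
  app := b
  naturality := fun i _ f => (h f).trans (Category.comp_id (b i)).symm

section GlueLimit

variable {I : Type} [SmallCategory I] {U V W : I ⥤ Scheme.{0}} (w₁ : W ⟶ U) (w₂ : W ⟶ V)

theorem exists_glueFunctor
    (hw₁ : ∀ i, IsOpenImmersion (w₁.app i)) (hw₂ : ∀ i, IsOpenImmersion (w₂.app i)) :
    ∃ (D : I ⥤ Scheme.{0}) (ιU : U ⟶ D) (ιV : V ⟶ D),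
      ∀ i, IsGlue (w₁.app i) (w₂.app i) (ιU.app i) (ιV.app i) := by
  have := fun i => exists_isGlue (w₁.app i) (w₂.app i)
  choose P j₁ j₂ h using this
  have comm : ∀ {i i'} (f : i ⟶ i'), w₁.app i ≫ U.map f ≫ j₁ i' = w₂.app i ≫ V.map f ≫ j₂ i' := by
    intro i i' f
    rw [← Category.assoc, ← Category.assoc, ← w₁.naturality, ← w₂.naturality, Category.assoc,
        Category.assoc, (h i').w]
  let D : I ⥤ Scheme.{0} :=
    { obj := P
      map := fun {i i'} f => (h i).desc (U.map f ≫ j₁ i') (V.map f ≫ j₂ i') (comm f)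
      map_id := fun i => by
        apply (h i).hom_ext <;> simp
      map_comp := fun f g => by
        apply (h _).hom_ext <;> simp }
  exact ⟨D, { app := j₁, naturality := fun i i' f => ((h i).inl_desc _ _ (comm f)).symm },
    { app := j₂, naturality := fun i i' f => ((h i).inr_desc _ _ (comm f)).symm }, h⟩

/-- The limit of a system of glued schemes is the glue of the limits. -/
theorem glue_limit {D : I ⥤ Scheme.{0}} {ιU : U ⟶ D} {ιV : V ⟶ D}
    (G : ∀ i, IsGlue (w₁.app i) (w₂.app i) (ιU.app i) (ιV.app i))
    (t : I) (ht : IsTerminal t)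
    (e₁ : ∀ {i i' : I} (f : i ⟶ i'), IsPullback (W.map f) (w₁.app i) (w₁.app i') (U.map f))
    (e₂ : ∀ {i i' : I} (f : i ⟶ i'), IsPullback (W.map f) (w₂.app i) (w₂.app i') (V.map f))
    (cU : Cone U) (hU : IsLimit cU) (cV : Cone V) (hV : IsLimit cV)
    {W₀ B : Scheme.{0}} {a₁ : W₀ ⟶ cU.pt} {a₂ : W₀ ⟶ cV.pt} {j₁ : cU.pt ⟶ B} {j₂ : cV.pt ⟶ B}
    (hB : IsGlue a₁ a₂ j₁ j₂) (ω : ∀ i, W₀ ⟶ W.obj i)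
    (p₁ : ∀ i, IsPullback (ω i) a₁ (w₁.app i) (cU.π.app i))
    (p₂ : ∀ i, IsPullback (ω i) a₂ (w₂.app i) (cV.π.app i))
    (aU : ∀ {i i' : I} (f : i ⟶ i'), IsAffineHom (U.map f))
    (aV : ∀ {i i' : I} (f : i ⟶ i'), IsAffineHom (V.map f)) :
    (∀ {i i' : I} (f : i ⟶ i'), IsAffineHom (D.map f)) ∧
    ∃ (c : Cone D), Nonempty (IsLimit c) ∧ c.pt = B := by
  have q₁ : ∀ {i i' : I} (f : i ⟶ i'), IsPullback (U.map f) (ιU.app i) (ιU.app i') (D.map f) :=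
    fun f => (G _).isPullback_left (G _) (e₂ f) (ιU.naturality f).symm (ιV.naturality f).symm
  have q₂ : ∀ {i i' : I} (f : i ⟶ i'), IsPullback (V.map f) (ιV.app i) (ιV.app i') (D.map f) :=
    fun f => (G _).isPullback_right (G _) (e₁ f) (ιU.naturality f).symm (ιV.naturality f).symm
  have inst : IsZariskiLocalAtTarget (@IsAffineHom : MorphismProperty Scheme.{0}) :=
    (HasAffineProperty.iff.mp instHasAffinePropertyIsAffineHomIsAffine).1
  refine ⟨fun f => (G _).of_target @IsAffineHom (q₁ f) (q₂ f) (aU f) (aV f), ?_⟩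
  let b : ∀ i, B ⟶ D.obj i := fun i => hB.desc (cU.π.app i ≫ ιU.app i)
    (cV.π.app i ≫ ιV.app i) (by
      rw [← Category.assoc, ← Category.assoc]
      refine Eq.trans (congrArg (· ≫ ιU.app i) (p₁ i).w.symm) (Eq.trans ?_
        (congrArg (· ≫ ιV.app i) (p₂ i).w))
      simp only [Category.assoc, (G i).w])
  have b₁ : ∀ i, j₁ ≫ b i = cU.π.app i ≫ ιU.app i := fun i => hB.inl_desc _ _ _
  have b₂ : ∀ i, j₂ ≫ b i = cV.π.app i ≫ ιV.app i := fun i => hB.inr_desc _ _ _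
  clear_value b
  have bnat : ∀ {i i' : I} (f : i ⟶ i'), b i ≫ D.map f = b i' := by
    intro i i' f
    apply hB.hom_ext
    · rw [b₁, ← Category.assoc, b₁, Category.assoc, ← ιU.naturality, ← Category.assoc, cU.w]
    · rw [b₂, ← Category.assoc, b₂, Category.assoc, ← ιV.naturality, ← Category.assoc, cV.w]
  refine ⟨mkCone D B b bnat, ?_, rfl⟩
  have hb₁ : ∀ i, IsPullback (cU.π.app i) j₁ (ιU.app i) (b i) := fun i =>
    hB.isPullback_left (G i) (p₂ i) (b₁ i) (b₂ i)
  have hb₂ : ∀ i, IsPullback (cV.π.app i) j₂ (ιV.app i) (b i) := fun i =>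
    hB.isPullback_right (G i) (p₁ i) (b₁ i) (b₂ i)
  let δ : D ⟶ (Functor.const I).obj (D.obj t) :=
    mkConst D (D.obj t) (fun i => D.map (ht.from i)) (by
        intro i i' f
        rw [← Functor.map_comp]
        congr 1
        exact ht.hom_ext _ _)
  have := (G t).o₁
  have := (G t).o₂
  have : Nonempty I := ⟨t⟩
  have cδ : ∀ (s : Cone D) i, s.π.app i ≫ δ.app i = s.π.app t :=
    fun s i => s.w _
  refine local_isLimit (mkCone D B b bnat) δ (cover2 (ιU.app t) (ιV.app t) (G t).cov)
    (fun k => Bool.rec V U k) (fun k => Bool.rec ιV ιU k)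
    (fun k => Bool.rec (fun i => V.map (ht.from i)) (fun i => U.map (ht.from i)) k)
    ?_ (fun k => Bool.rec cV cU k) (fun k => Bool.rec hV hU k) (fun k => Bool.rec j₂ j₁ k)
    ?_ ?_ (fun s i i' => (cδ s i).trans (cδ s i').symm)
  · intro k i
    cases k
    · exact q₂ (ht.from i)
    · exact q₁ (ht.from i)
  · intro k i
    cases k
    · exact b₂ i
    · exact b₁ i
  · have r₁ : ∀ i, IsPullback (cU.π.app i ≫ U.map (ht.from i)) j₁ (ιU.app t)
        (b i ≫ D.map (ht.from i)) := by
      intro i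
      rw [bnat, cU.w]
      exact hb₁ t
    have r₂ : ∀ i, IsPullback (cV.π.app i ≫ V.map (ht.from i)) j₂ (ιV.app t)
        (b i ≫ D.map (ht.from i)) := by
      intro i
      rw [bnat, cV.w]
      exact hb₂ t
    intro k i
    cases k
    · exact r₂ i
    · exact r₁ i

end GlueLimit

end ModelProof

namespace ModelProof

/-- The basic open of an affine scheme. -/
def DD {A : CommRingCat.{0}} (f : A) : (Spec A).Opens := PrimeSpectrum.basicOpen f

theorem toSpec_preimage_basicOpen {W : Scheme.{0}} {A : CommRingCat.{0}} (ψ : A ⟶ Γ(W, ⊤)) (f : A) :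
    (W.toSpecΓ ≫ Spec.map ψ) ⁻¹ᵁ (DD f) = W.basicOpen (ψ f) := by
  rw [← Scheme.toSpecΓ_preimage_basicOpen]
  rfl

theorem toSpec_app_algebraMap {W : Scheme.{0}} {A : CommRingCat.{0}} (ψ : A ⟶ Γ(W, ⊤)) 
    (U : (Spec A).Opens) :
    CommRingCat.ofHom (algebraMap A Γ(Spec A, U)) ≫ (W.toSpecΓ ≫ Spec.map ψ).app U =
      ψ ≫ W.presheaf.map (homOfLE le_top).op := by
  have : CommRingCat.ofHom (algebraMap A Γ(Spec A, U)) = (Scheme.ΓSpecIso A).inv ≫ (Spec A).presheaf.map (homOfLE le_top).op := rfl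
  rw [this, Category.assoc, Scheme.Hom.naturality]
  simp
  rfl

theorem isIso_of_appTop {X Y : Scheme.{0}} (f : X ⟶ Y) [IsAffine X] [IsAffine Y]
    (h : IsIso f.appTop) : IsIso f := by
  rw [← isIso_comp_right_iff f Y.isoSpec.hom]
  have := Scheme.toSpecΓ_naturality f
  exact this ▸ inferInstance

theorem isIso_morphismRestrict_of_affine {X Y : Scheme.{0}} (f : X ⟶ Y) {U : Y.Opens}
    (hU : IsAffineOpen U) (hU' : IsAffineOpen (f ⁻¹ᵁ U)) (h : IsIso (f.app U)) : IsIso (f ∣_ U) := by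
  have : IsAffine U := hU
  have : IsAffine (f ⁻¹ᵁ U : X.Opens) := hU'
  suffices IsIso (f ∣_ U).appTop from
    isIso_of_appTop _ this
  rw [Scheme.Hom.app_eq_appLE] at h
  simp only [morphismRestrict_app', TopologicalSpace.Opens.map_top]
  have aux : ∀ (V : Y.Opens) (O : X.Opens) (e : O ≤ f ⁻¹ᵁ V), U = V → f ⁻¹ᵁ U = O →
      IsIso (f.appLE V O e) := by
    rintro V O e rfl rfl
    exact h
  exact aux _ _ _ (by simp) (by simp)

theorem bijective_of_away {A A' G G' : Type*} [CommRing A] [CommRing A'] [CommRing G] [CommRing G']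
    [Algebra A A'] [Algebra G G'] (ψ : A →+* G) (f : A) [IsLocalization.Away f A']
    [IsLocalization.Away (ψ f) G'] (q : A' →+* G')
    (key' : ∀ a, q (algebraMap A A' a) = algebraMap G G' (ψ a))
    (inj : ∀ a : A, (∃ n : ℕ, ψ f ^ n * ψ a = 0) → ∃ m : ℕ, f ^ m * a = 0)
    (surj : ∀ b : G, ∃ (n : ℕ) (a : A), ψ a = ψ f ^ n * b) : Function.Bijective q := by
  constructor
  · rw [injective_iff_map_eq_zero]
    intro x hx
    obtain ⟨a, ⟨_, n, rfl⟩, rfl⟩ := IsLocalization.exists_mk'_eq (Submonoid.powers f) x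
    have h1 : algebraMap A A' a = 
       algebraMap A A' (f^n) * IsLocalization.mk' A' a (⟨f ^ n, n, rfl⟩ : Submonoid.powers f) := 
        (IsLocalization.mk'_spec' A' a (⟨f ^ n, n, rfl⟩ : Submonoid.powers f)).symm
    have h2 := key' a
    have h3 : algebraMap G G' (ψ a) = 0 := by
      rw [← h2, h1, map_mul, hx, mul_zero]
    obtain ⟨⟨_, m, rfl⟩, hm⟩ := (IsLocalization.map_eq_zero_iff (Submonoid.powers (ψ f)) _ _).1 h3
    obtain ⟨k, hk⟩ := inj a ⟨m, hm⟩
    rw [IsLocalization.mk'_eq_zero_iff]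
    exact ⟨⟨_, k, rfl⟩, hk⟩
  · intro y
    obtain ⟨b, ⟨_, n, rfl⟩, rfl⟩ := IsLocalization.exists_mk'_eq (Submonoid.powers (ψ f)) y
    obtain ⟨m, a, ha⟩ := surj b
    refine ⟨IsLocalization.mk' _ a (⟨f ^ (m + n), m + n, rfl⟩ : Submonoid.powers f), ?_⟩
    symm
    rw [IsLocalization.mk'_eq_iff_eq_mul]
    have h1 : algebraMap A A' a = 
       algebraMap A A' (f^(m+n)) * IsLocalization.mk' A' a (⟨f ^ (m+n), m+n, rfl⟩ : Submonoid.powers f) := 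
        (IsLocalization.mk'_spec' A' a (⟨f ^ (m+n), m+n, rfl⟩ : Submonoid.powers f)).symm
    have h2 := key' a
    rw [h1, ha, map_mul, key'] at h2
    have hu := IsLocalization.map_units G' (⟨ψ f ^ m, m, rfl⟩ : Submonoid.powers (ψ f))
    rw [← hu.mul_right_inj]
    simp only [map_mul, map_pow] at h2 ⊢
    rw [← h2, pow_add]
    ring

theorem isIso_app_toSpec {W : Scheme.{0}} [CompactSpace W] [QuasiSeparatedSpace W]
    {A : CommRingCat.{0}} (ψ : A ⟶ Γ(W, ⊤)) (f : A)
    (inj : ∀ a : A, (∃ n : ℕ, ψ f ^ n * ψ a = 0) → ∃ m : ℕ, f ^ m * a = 0)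
    (surj : ∀ b : Γ(W, ⊤), ∃ (n : ℕ) (a : A), ψ a = ψ f ^ n * b) :
    IsIso ((W.toSpecΓ ≫ Spec.map ψ).app (DD f)) := by
  have e := toSpec_preimage_basicOpen ψ f
  have hl : IsLocalization.Away f Γ(Spec A, DD f) :=
    StructureSheaf.IsLocalization.to_basicOpen A f
  have key := toSpec_app_algebraMap ψ (DD f)
  generalize W.toSpecΓ ≫ Spec.map ψ = p at *
  generalize p.app (DD f) = q at *
  generalize DD f = U at *
  revert q
  generalize p ⁻¹ᵁ U = O at *
  subst e
  intro q key
  have hloc : IsLocalization.Away (ψ.hom f) Γ(W, W.basicOpen (ψ.hom f)) := isLocalization_basicOpen_of_qcqs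
    CompactSpace.isCompact_univ isQuasiSeparated_univ _
  rw [ConcreteCategory.isIso_iff_bijective]
  exact bijective_of_away ψ.hom f q.hom (fun a => congr($key a)) inj surj

theorem isOpenImmersion_toSpec {W : Scheme.{0}} [CompactSpace W] [QuasiSeparatedSpace W]
    {A : CommRingCat.{0}} (ψ : A ⟶ Γ(W, ⊤)) {κ : Type*} (f : κ → A)
    (cov : ⨆ k, W.basicOpen (ψ (f k)) = ⊤) (aff : ∀ k, IsAffineOpen (W.basicOpen (ψ (f k))))
    (inj : ∀ k, ∀ a : A, (∃ n : ℕ, ψ (f k) ^ n * ψ a = 0) → ∃ m : ℕ, f k ^ m * a = 0)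
    (surj : ∀ k, ∀ b : Γ(W, ⊤), ∃ (n : ℕ) (a : A), ψ a = ψ (f k) ^ n * b) :
    IsOpenImmersion (W.toSpecΓ ≫ Spec.map ψ) ∧ 
      Set.range (W.toSpecΓ ≫ Spec.map ψ) = (⨆ k, DD (f k) : (Spec A).Opens) := by
  have e := fun k => toSpec_preimage_basicOpen ψ (f k)
  have hiso := fun k => isIso_app_toSpec ψ (f k) (inj k) (surj k)
  generalize hp : W.toSpecΓ ≫ Spec.map ψ = p at *
  have hr : ∀ k, IsIso (p ∣_ (DD (f k))) := fun k =>
    isIso_morphismRestrict_of_affine p (IsAffineOpen.Spec_basicOpen _) (by rw [e]; exact aff k) (hiso k)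
  have hsub : Set.range p ⊆ (⨆ k, DD (f k) : (Spec A).Opens) := by
    rintro _ ⟨x, rfl⟩
    have hx : x ∈ (⨆ k, W.basicOpen (ψ (f k))) := by rw [cov]; trivial
    obtain ⟨k, hk⟩ := TopologicalSpace.Opens.mem_iSup.1 hx
    rw [← e] at hk
    exact TopologicalSpace.Opens.mem_iSup.2 ⟨k, hk⟩
  refine ⟨IsZariskiLocalAtTarget.of_range_subset_iSup (P := @IsOpenImmersion) _ hsub (fun k => inferInstance), 
    le_antisymm hsub ?_⟩
  intro y hy
  obtain ⟨k, hk⟩ := TopologicalSpace.Opens.mem_iSup.1 hy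
  have := hr k
  let y' : DD (f k) := ⟨y, hk⟩
  obtain ⟨x, hx⟩ := (p ∣_ (DD (f k))).surjective y'
  refine ⟨(p ⁻¹ᵁ (DD (f k))).ι x, ?_⟩
  have := congr($(morphismRestrict_ι p (DD (f k))) x)
  exact this.symm.trans (congrArg (Scheme.Opens.ι _) hx)

end ModelProof

namespace ModelProof

/-- The data characterising an open immersion into an affine scheme. -/
structure OIData (W : Scheme.{0}) {A : CommRingCat.{0}} (ψ : A ⟶ Γ(W, ⊤)) {κ : Type} (f : κ → A) :
    Prop where
  cov : ⨆ k, W.basicOpen (ψ (f k)) = ⊤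
  aff : ∀ k, IsAffineOpen (W.basicOpen (ψ (f k)))
  inj : ∀ k, ∀ a : A, (∃ n : ℕ, ψ (f k) ^ n * ψ a = 0) → ∃ m : ℕ, f k ^ m * a = 0
  surj : ∀ k, ∀ b : Γ(W, ⊤), ∃ (n : ℕ) (a : A), ψ a = ψ (f k) ^ n * b

theorem OIData.isOpenImmersion {W : Scheme.{0}} [CompactSpace W] [QuasiSeparatedSpace W]
    {A : CommRingCat.{0}} {ψ : A ⟶ Γ(W, ⊤)} {κ : Type} {f : κ → A} (h : OIData W ψ f) :
    IsOpenImmersion (W.toSpecΓ ≫ Spec.map ψ) ∧ 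
      Set.range (W.toSpecΓ ≫ Spec.map ψ) = (⨆ k, DD (f k) : (Spec A).Opens) :=
  isOpenImmersion_toSpec ψ f h.cov h.aff h.inj h.surj

/-- The ring map associated with a morphism to an affine scheme. -/
noncomputable def toΓ {W : Scheme.{0}} {A : CommRingCat.{0}} (p : W ⟶ Spec A) : A ⟶ Γ(W, ⊤) :=
  (Scheme.ΓSpecIso A).inv ≫ p.appTop

theorem toSpecΓ_toΓ {W : Scheme.{0}} {A : CommRingCat.{0}} (p : W ⟶ Spec A) :
    W.toSpecΓ ≫ Spec.map (toΓ p) = p := by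
  rw [toΓ, Spec.map_comp, ← Category.assoc, ← Scheme.toSpecΓ_naturality, Category.assoc,
    toSpecΓ_SpecMap_ΓSpecIso_inv, Category.comp_id]

theorem inj_surj_of_bijective {A A' G G' : Type*} [CommRing A] [CommRing A'] [CommRing G] [CommRing G']
    [Algebra A A'] [Algebra G G'] (ψ : A →+* G) (f : A) [IsLocalization.Away f A']
    [IsLocalization.Away (ψ f) G'] (q : A' →+* G')
    (key' : ∀ a, q (algebraMap A A' a) = algebraMap G G' (ψ a))
    (hq : Function.Bijective q) : 
    (∀ a : A, (∃ n : ℕ, ψ f ^ n * ψ a = 0) → ∃ m : ℕ, f ^ m * a = 0) ∧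
    (∀ b : G, ∃ (n : ℕ) (a : A), ψ a = ψ f ^ n * b) := by
  constructor
  · rintro a ⟨n, hn⟩
    have h1 : algebraMap G G' (ψ a) = 0 :=
      (IsLocalization.map_eq_zero_iff (Submonoid.powers (ψ f)) _ _).2 ⟨⟨_, n, rfl⟩, hn⟩
    rw [← key'] at h1
    have h2 := hq.1 (h1.trans (map_zero q).symm)
    obtain ⟨⟨_, m, rfl⟩, hm⟩ := (IsLocalization.map_eq_zero_iff (Submonoid.powers f) _ _).1 h2
    exact ⟨m, hm⟩
  · intro b
    obtain ⟨x, hx⟩ := hq.2 (algebraMap G G' b)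
    obtain ⟨a, ⟨_, n, rfl⟩, rfl⟩ := IsLocalization.exists_mk'_eq (Submonoid.powers f) x
    have h1 : algebraMap A A' (f^n) * IsLocalization.mk' A' a (⟨f ^ n, n, rfl⟩ : Submonoid.powers f) = algebraMap A A' a := 
        (IsLocalization.mk'_spec' A' a (⟨f ^ n, n, rfl⟩ : Submonoid.powers f))
    have h2 := congrArg q h1
    rw [map_mul, hx, key', key', ← map_mul] at h2
    obtain ⟨⟨_, m, rfl⟩, hm⟩ := (IsLocalization.eq_iff_exists (Submonoid.powers (ψ f)) _).1 h2
    refine ⟨m + n, f ^ m * a, ?_⟩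
    simp only [map_mul, map_pow] at hm ⊢
    rw [← hm]
    ring

theorem inj_surj_toSpec {W : Scheme.{0}} [CompactSpace W] [QuasiSeparatedSpace W]
    {A : CommRingCat.{0}} (ψ : A ⟶ Γ(W, ⊤)) (f : A)
    (hiso : IsIso ((W.toSpecΓ ≫ Spec.map ψ).app (DD f))) :
    (∀ a : A, (∃ n : ℕ, ψ f ^ n * ψ a = 0) → ∃ m : ℕ, f ^ m * a = 0) ∧
    (∀ b : Γ(W, ⊤), ∃ (n : ℕ) (a : A), ψ a = ψ f ^ n * b) := by
  have e := toSpec_preimage_basicOpen ψ f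
  have hl : IsLocalization.Away f Γ(Spec A, DD f) :=
    StructureSheaf.IsLocalization.to_basicOpen A f
  have key := toSpec_app_algebraMap ψ (DD f)
  generalize W.toSpecΓ ≫ Spec.map ψ = p at *
  generalize p.app (DD f) = q at *
  generalize DD f = U at *
  revert q
  generalize p ⁻¹ᵁ U = O at *
  subst e
  intro q hiso key
  have hloc : IsLocalization.Away (ψ.hom f) Γ(W, W.basicOpen (ψ.hom f)) := isLocalization_basicOpen_of_qcqs
    CompactSpace.isCompact_univ isQuasiSeparated_univ _
  rw [ConcreteCategory.isIso_iff_bijective] at hiso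
  exact inj_surj_of_bijective ψ.hom f q.hom (fun a => congr($key a)) hiso

theorem exists_OIData {W : Scheme.{0}} [CompactSpace W] {A : CommRingCat.{0}} (ψ : A ⟶ Γ(W, ⊤))
    (hp : IsOpenImmersion (W.toSpecΓ ≫ Spec.map ψ)) :
    ∃ (κ : Type) (_ : Finite κ) (f : κ → A), OIData W ψ f := by
  have : QuasiSeparatedSpace W := QuasiSeparatedSpace.of_isOpenEmbedding
    (W.toSpecΓ ≫ Spec.map ψ).isOpenEmbedding
  have hc : IsCompact (Set.range (W.toSpecΓ ≫ Spec.map ψ)) := 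
    isCompact_range (W.toSpecΓ ≫ Spec.map ψ).continuous
  have ho : IsOpen (Set.range (W.toSpecΓ ≫ Spec.map ψ)) := 
    (W.toSpecΓ ≫ Spec.map ψ).isOpenEmbedding.isOpen_range
  obtain ⟨s, hs⟩ := PrimeSpectrum.isCompact_isOpen_iff.1 ⟨hc, ho⟩
  have hle : ∀ k : s, DD k.1 ≤ (W.toSpecΓ ≫ Spec.map ψ).opensRange := by
    intro k x hx
    change x ∈ Set.range (W.toSpecΓ ≫ Spec.map ψ)
    rw [← hs]
    intro h
    exact hx (h k.2)
  refine ⟨s, inferInstance, fun k => k.1, ?_, ?_, ?_, ?_⟩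
  · refine top_le_iff.1 fun x _ => ?_
    have hx : (W.toSpecΓ ≫ Spec.map ψ) x ∈ Set.range (W.toSpecΓ ≫ Spec.map ψ) := ⟨x, rfl⟩
    rw [← hs] at hx
    have hx' : ¬ ∀ k ∈ s, k ∈ ((W.toSpecΓ ≫ Spec.map ψ) x).asIdeal := hx
    push Not at hx'
    obtain ⟨k, hk, hkx⟩ := hx'
    refine TopologicalSpace.Opens.mem_iSup.2 ⟨⟨k, hk⟩, ?_⟩
    rw [← toSpec_preimage_basicOpen]
    exact hkx
  · intro k
    rw [← toSpec_preimage_basicOpen]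
    exact (IsAffineOpen.Spec_basicOpen _).preimage_of_isOpenImmersion _ (hle k)
  · intro k
    exact (inj_surj_toSpec ψ k.1 (Scheme.Hom.isIso_app _ _ (hle k))).1
  · intro k
    exact (inj_surj_toSpec ψ k.1 (Scheme.Hom.isIso_app _ _ (hle k))).2

end ModelProof

namespace ModelProof
open Opposite

/-- Schemes obtained from schemes of finite type over `ℤ` by iterated cofiltered limits
with affine transition maps. -/
inductive Good : Scheme.{0} → Prop
  | ofFT (B : Scheme.{0}) (a : B ⟶ Spec (CommRingCat.of ℤ)) (h₁ : LocallyOfFiniteType a)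
      (h₂ : QuasiCompact a) : Good B
  | lim {I : Type} [SmallCategory I] [IsCofiltered I] (D : I ⥤ Scheme.{0}) (c : Cone D)
      (hc : IsLimit c) (haff : ∀ {i j : I} (f : i ⟶ j), IsAffineHom (D.map f))
      (hcpt : ∀ i, CompactSpace (D.obj i)) (hqs : ∀ i, QuasiSeparatedSpace (D.obj i))
      (ih : ∀ i, Good (D.obj i)) : Good c.pt

/-- Recognition of filtered colimits of rings. -/
noncomputable def isColimitRing {J : Type} [SmallCategory J] [IsFiltered J] (F : J ⥤ CommRingCat.{0})
    (c : Cocone F) (hs : ∀ r : c.pt, ∃ (i : J) (x : F.obj i), c.ι.app i x = r)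
    (hi : ∀ (i : J) (x y : F.obj i), c.ι.app i x = c.ι.app i y → ∃ (k : J) (f : i ⟶ k),
      F.map f x = F.map f y) : IsColimit c := by
  have : ReflectsColimit F (forget CommRingCat.{0}) := reflectsColimit_of_reflectsIsomorphisms _ _
  refine isColimitOfReflects (forget CommRingCat.{0}) ?_
  refine Types.FilteredColimit.isColimitOf' _ _ ?_ ?_
  · intro r
    obtain ⟨i, x, hx⟩ := hs r
    exact ⟨i, x, hx.symm⟩
  · intro i x y h
    exact hi i x y h

/-- Spec of a filtered colimit. -/
noncomputable def specLimit {I : Type} [SmallCategory I] (F : Iᵒᵖ ⥤ CommRingCat.{0}) (c : Cocone F)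
    (hc : IsColimit c) : IsLimit (Scheme.Spec.mapCone (coneRightOpOfCocone c)) :=
  isLimitOfPreserves Scheme.Spec (isLimitConeRightOpOfCocone F hc)

theorem preimage_DD {A A' : CommRingCat.{0}} (φ : A ⟶ A') {κ : Type} (f : κ → A) :
    (Spec.map φ) ⁻¹ᵁ (⨆ k, DD (f k)) = ⨆ k, DD (φ (f k)) := by
  rw [Scheme.Hom.preimage_iSup]
  rfl

theorem toSpec_naturality {W W' : Scheme.{0}} {A A' : CommRingCat.{0}} (φ : A ⟶ A') (g : W' ⟶ W)
    (ψ : A ⟶ Γ(W, ⊤)) (ψ' : A' ⟶ Γ(W', ⊤)) (h : φ ≫ ψ' = ψ ≫ g.appTop) :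
    (W'.toSpecΓ ≫ Spec.map ψ') ≫ Spec.map φ = g ≫ W.toSpecΓ ≫ Spec.map ψ := by
  rw [Category.assoc, ← Spec.map_comp, h, Spec.map_comp, ← Category.assoc, 
    ← Scheme.toSpecΓ_naturality, Category.assoc]

theorem OIData.isPullback {W W' : Scheme.{0}} [CompactSpace W] [QuasiSeparatedSpace W]
    [CompactSpace W'] [QuasiSeparatedSpace W'] {A A' : CommRingCat.{0}} (φ : A ⟶ A') (g : W' ⟶ W)
    {ψ : A ⟶ Γ(W, ⊤)} {ψ' : A' ⟶ Γ(W', ⊤)} (h : φ ≫ ψ' = ψ ≫ g.appTop)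
    {κ : Type} {f : κ → A} (hf : OIData W ψ f) (hf' : OIData W' ψ' (fun k => φ (f k))) :
    IsPullback g (W'.toSpecΓ ≫ Spec.map ψ') (W.toSpecΓ ≫ Spec.map ψ) (Spec.map φ) := by
  have := hf.isOpenImmersion.1
  have := hf'.isOpenImmersion.1
  refine IsOpenImmersion.isPullback _ _ _ _ (toSpec_naturality φ g ψ ψ' h) ?_
  have h1 : (W.toSpecΓ ≫ Spec.map ψ).opensRange = ⨆ k, DD (f k) :=
    TopologicalSpace.Opens.ext hf.isOpenImmersion.2
  have h2 : (W'.toSpecΓ ≫ Spec.map ψ').opensRange = ⨆ k, DD (φ (f k)) :=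
    TopologicalSpace.Opens.ext hf'.isOpenImmersion.2
  rw [h1, h2, preimage_DD]

theorem good_glue {I : Type} [SmallCategory I] [IsCofiltered I] {t : I} (ht : IsTerminal t)
    {U W : I ⥤ Scheme.{0}} (w₁ : W ⟶ U) (hw₁ : ∀ i, IsOpenImmersion (w₁.app i))
    (e₁ : ∀ {i i' : I} (f : i ⟶ i'), IsPullback (W.map f) (w₁.app i) (w₁.app i') (U.map f))
    (aU : ∀ {i i' : I} (f : i ⟶ i'), IsAffineHom (U.map f))
    (hUc : ∀ i, CompactSpace (U.obj i)) (hUq : ∀ i, QuasiSeparatedSpace (U.obj i))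
    (hWc : ∀ i, CompactSpace (W.obj i))
    (cU : Cone U) (hU : IsLimit cU)
    (F : Iᵒᵖ ⥤ CommRingCat.{0}) (cF : Cocone F)
    (hs : ∀ r : cF.pt, ∃ (i : I) (x : F.obj (op i)), cF.ι.app (op i) x = r)
    (hi : ∀ (i : I) (x y : F.obj (op i)), cF.ι.app (op i) x = cF.ι.app (op i) y →
      ∃ (k : I) (f : k ⟶ i), F.map f.op x = F.map f.op y)
    (ψ : ∀ i, F.obj (op i) ⟶ Γ(W.obj i, ⊤))
    (hψ : ∀ {i j : I} (g : i ⟶ j), F.map g.op ≫ ψ i = ψ j ≫ (W.map g).appTop)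
    {κ : Type} (f : κ → F.obj (op t))
    (hf : ∀ i, OIData (W.obj i) (ψ i) (fun k => F.map (ht.from i).op (f k)))
    {W₀ B : Scheme.{0}} [CompactSpace W₀] {a₁ : W₀ ⟶ cU.pt} (ψ₀ : cF.pt ⟶ Γ(W₀, ⊤))
    {j₁ : cU.pt ⟶ B} {j₂ : Spec cF.pt ⟶ B} (hB : IsGlue a₁ (W₀.toSpecΓ ≫ Spec.map ψ₀) j₁ j₂)
    (ω : ∀ i, W₀ ⟶ W.obj i)
    (p₁ : ∀ i, IsPullback (ω i) a₁ (w₁.app i) (cU.π.app i))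
    (hω : ∀ i, cF.ι.app (op i) ≫ ψ₀ = ψ i ≫ (ω i).appTop)
    (hf₀ : OIData W₀ ψ₀ (fun k => cF.ι.app (op t) (f k)))
    (hG : ∀ i (P : Scheme.{0}) (k₁ : U.obj i ⟶ P) (k₂ : Spec (F.obj (op i)) ⟶ P),
      IsGlue (w₁.app i) ((W.obj i).toSpecΓ ≫ Spec.map (ψ i)) k₁ k₂ → Good P) : Good B := by
  have hWq : ∀ i, QuasiSeparatedSpace (W.obj i) := fun i =>
    QuasiSeparatedSpace.of_isOpenEmbedding (w₁.app i).isOpenEmbedding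
  have hO := fun i => (hf i).isOpenImmersion.1
  have : QuasiSeparatedSpace W₀ := by
    have := hB.isOpenImmersion_right
    exact QuasiSeparatedSpace.of_isOpenEmbedding (W₀.toSpecΓ ≫ Spec.map ψ₀).isOpenEmbedding
  let V : I ⥤ Scheme.{0} := F.rightOp ⋙ Scheme.Spec
  have hVm : ∀ {i j : I} (g : i ⟶ j), V.map g = Spec.map (F.map g.op) := fun g => rfl
  have hVa : ∀ {i j : I} (g : i ⟶ j), IsAffineHom (V.map g) := fun {i j} g => 
    inferInstanceAs (IsAffineHom (Spec.map (F.map g.op)))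
  let w₂ : W ⟶ V := 
    { app := fun i => (W.obj i).toSpecΓ ≫ Spec.map (ψ i)
      naturality := fun i j g => (toSpec_naturality _ _ _ _ (hψ g)).symm }
  have hw₂ : ∀ i, w₂.app i = (W.obj i).toSpecΓ ≫ Spec.map (ψ i) := fun i => rfl
  have hF : ∀ {i j : I} (g : i ⟶ j) (k : κ), F.map g.op (F.map (ht.from j).op (f k)) = 
      F.map (ht.from i).op (f k) := by
    intro i j g k
    rw [← ConcreteCategory.comp_apply, ← F.map_comp, ← op_comp, ht.hom_ext (g ≫ ht.from j) (ht.from i)]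
  have hcF : ∀ (i : I) (k : κ), cF.ι.app (op i) (F.map (ht.from i).op (f k)) = 
      cF.ι.app (op t) (f k) := by
    intro i k
    rw [← ConcreteCategory.comp_apply, cF.w]
  have e₂ : ∀ {i i' : I} (f : i ⟶ i'), IsPullback (W.map f) (w₂.app i) (w₂.app i') (V.map f) := by
    intro i j g
    refine OIData.isPullback (F.map g.op) (W.map g) (hψ g) (hf j) ?_
    simp only [hF]
    exact hf i
  have hcol : IsColimit cF := isColimitRing F cF
    (fun r => by obtain ⟨i, x, hx⟩ := hs r; exact ⟨op i, x, hx⟩)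
    (fun i x y h => by obtain ⟨k, g, hg⟩ := hi i.unop x y h; exact ⟨op k, g.op, hg⟩)
  have p₂ : ∀ i, IsPullback (ω i) (W₀.toSpecΓ ≫ Spec.map ψ₀) (w₂.app i) (Spec.map (cF.ι.app (op i))) := by
    intro i
    refine OIData.isPullback (cF.ι.app (op i)) (ω i) (hω i) (hf i) ?_
    simp only [hcF]
    exact hf₀
  obtain ⟨D, ιU, ιV, G⟩ := exists_glueFunctor w₁ w₂ hw₁ hO
  have G' : ∀ i, IsGlue (w₁.app i) ((W.obj i).toSpecΓ ≫ Spec.map (ψ i)) (ιU.app i) (ιV.app i) := G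
  obtain ⟨haff, c, ⟨hc⟩, rfl⟩ := glue_limit w₁ w₂ G t ht e₁ e₂ cU hU _ (specLimit F cF hcol)
    hB ω p₁ p₂ aU hVa
  refine Good.lim D c hc haff (fun i => ?_) (fun i => ?_) (fun i => hG i _ _ _ (G' i))
  · have : CompactSpace (V.obj i) := inferInstanceAs (CompactSpace (Spec (F.obj (op i))))
    exact (G i).compactSpace
  · have : QuasiSeparatedSpace (V.obj i) := inferInstanceAs (QuasiSeparatedSpace (Spec (F.obj (op i))))
    exact (G i).quasiSeparatedSpace

end ModelProof

namespace ModelProof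
open Opposite

theorem exists_finset_surj {R G G' : Type} [CommRing R] [CommRing G] [CommRing G'] [Algebra G G']
    (ψ : R →+* G) (f : R) [IsLocalization.Away (ψ f) G'] [Algebra.FiniteType ℤ G']
    (surj : ∀ b : G, ∃ (n : ℕ) (a : R), ψ a = ψ f ^ n * b) :
    ∃ F₀ : Finset R, ∀ R' : Subring R, (∀ x ∈ F₀, x ∈ R') → f ∈ R' →
      ∀ b : G, ∃ (n : ℕ) (a : R), a ∈ R' ∧ ψ a = ψ f ^ n * b := by
  classical
  obtain ⟨s, hs⟩ := (Algebra.FiniteType.out : (⊤ : Subalgebra ℤ G').FG)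
  have h1 : ∀ y : G', ∃ (n : ℕ) (a : R), algebraMap G G' (ψ a) = algebraMap G G' (ψ f) ^ n * y := by
    intro y
    obtain ⟨b, ⟨_, n, rfl⟩, rfl⟩ := IsLocalization.exists_mk'_eq (Submonoid.powers (ψ f)) y
    obtain ⟨m, a, ha⟩ := surj b
    refine ⟨m + n, a, ?_⟩
    have := IsLocalization.mk'_spec' G' b (⟨ψ f ^ n, n, rfl⟩ : Submonoid.powers (ψ f))
    rw [ha, map_mul, ← this, pow_add]
    simp only [map_pow]
    ring
  choose n a ha using h1
  refine ⟨s.image a, fun R' hR' hf => ?_⟩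
  have h2 : ∀ y : G', ∃ (n : ℕ) (a : R), a ∈ R' ∧ algebraMap G G' (ψ a) = algebraMap G G' (ψ f) ^ n * y := by
    intro y
    have hy : y ∈ Algebra.adjoin ℤ (s : Set G') := by rw [hs]; trivial
    induction hy using Algebra.adjoin_induction with
    | mem x hx => exact ⟨n x, a x, hR' _ (Finset.mem_image_of_mem _ hx), ha x⟩
    | algebraMap r => exact ⟨0, r, intCast_mem _ _, by simp⟩
    | add x y _ _ hx hy =>
      obtain ⟨n₁, a₁, h₁, e₁⟩ := hx
      obtain ⟨n₂, a₂, h₂, e₂⟩ := hy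
      refine ⟨n₁ + n₂, f ^ n₂ * a₁ + f ^ n₁ * a₂, add_mem (mul_mem (pow_mem hf _) h₁)
        (mul_mem (pow_mem hf _) h₂), ?_⟩
      simp only [map_add, map_mul, map_pow, e₁, e₂]
      ring
    | mul x y _ _ hx hy =>
      obtain ⟨n₁, a₁, h₁, e₁⟩ := hx
      obtain ⟨n₂, a₂, h₂, e₂⟩ := hy
      refine ⟨n₁ + n₂, a₁ * a₂, mul_mem h₁ h₂, ?_⟩
      simp only [map_mul, e₁, e₂]
      ring
  intro b
  obtain ⟨n, a, haR, e⟩ := h2 (algebraMap G G' b)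
  rw [← map_pow, ← map_mul] at e
  obtain ⟨⟨_, m, rfl⟩, hm⟩ := (IsLocalization.eq_iff_exists (Submonoid.powers (ψ f)) _).1 e
  refine ⟨m + n, f ^ m * a, mul_mem (pow_mem hf _) haR, ?_⟩
  simp only [map_mul, map_pow] at hm ⊢
  rw [hm]
  ring

theorem finiteType_Γ {W : Scheme.{0}} (a : W ⟶ Spec (CommRingCat.of ℤ)) [LocallyOfFiniteType a]
    {O : W.Opens} (hO : IsAffineOpen O) : Algebra.FiniteType ℤ Γ(W, O) := by
  have h1 := Scheme.Hom.finiteType_appLE a (isAffineOpen_top _) hO le_top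
  rw [← RingHom.finiteType_algebraMap]
  have h2 := h1.comp (RingHom.FiniteType.of_surjective (Scheme.ΓSpecIso (CommRingCat.of ℤ)).inv.hom
    (ConcreteCategory.bijective_of_isIso (Scheme.ΓSpecIso (CommRingCat.of ℤ)).inv).2)
  convert h2
  exact RingHom.ext_int _ _

theorem finiteType_closure {R : Type} [CommRing R] (s : Finset R) :
    Algebra.FiniteType ℤ (Subring.closure (s : Set R)) := by
  have h := (Subalgebra.fg_iff_finiteType _).1 (Subalgebra.fg_adjoin_finset (R := ℤ) s)
  have hm : ∀ x : Algebra.adjoin ℤ (s : Set R), x.1 ∈ Subring.closure (s : Set R) := by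
    rintro ⟨x, hx⟩
    rw [Algebra.adjoin_int] at hx
    exact hx
  let g : Algebra.adjoin ℤ (s : Set R) →+* Subring.closure (s : Set R) :=
    (Algebra.adjoin ℤ (s : Set R)).val.toRingHom.codRestrict _ hm
  refine Algebra.FiniteType.of_surjective (RingHom.toIntAlgHom g) ?_
  rintro ⟨x, hx⟩
  exact ⟨⟨x, by rw [Algebra.adjoin_int]; exact hx⟩, rfl⟩

theorem locallyOfFiniteType_specMap {R : CommRingCat.{0}} (h : Algebra.FiniteType ℤ R)
    (a : Spec R ⟶ Spec (CommRingCat.of ℤ)) : LocallyOfFiniteType a := by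
  have e : a = Spec.map (CommRingCat.ofHom (algebraMap ℤ R)) := specZIsTerminal.hom_ext _ _
  rw [e]
  exact (HasRingHomProperty.Spec_iff (P := @LocallyOfFiniteType)).2 (RingHom.finiteType_algebraMap.2 h)

/-- The subring generated by a finite set and a given one. -/
def clo {R : Type} [CommRing R] [DecidableEq R] (F₀ : Finset R) (s : Finset R) : Subring R :=
  Subring.closure ((s ∪ F₀ : Finset R) : Set R)

theorem clo_mono {R : Type} [CommRing R] [DecidableEq R] (F₀ : Finset R) {s s' : Finset R}
    (h : s ⊆ s') : clo F₀ s ≤ clo F₀ s' :=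
  Subring.closure_mono (Finset.coe_subset.2 (Finset.union_subset_union_left h))

theorem subset_clo {R : Type} [CommRing R] [DecidableEq R] (F₀ : Finset R) {s : Finset R} {x : R}
    (h : x ∈ F₀) : x ∈ clo F₀ s :=
  Subring.subset_closure (by simp [h])

theorem subset_clo' {R : Type} [CommRing R] [DecidableEq R] (F₀ : Finset R) {s : Finset R} {x : R}
    (h : x ∈ s) : x ∈ clo F₀ s :=
  Subring.subset_closure (by simp [h])

theorem clo_mono' {R : Type} [CommRing R] [DecidableEq R] (F₀ : Finset R) {s s' : (Finset R)ᵒᵈ}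
    (h : s ≤ s') : clo F₀ s'.ofDual ≤ clo F₀ s.ofDual :=
  clo_mono F₀ (OrderDual.ofDual_le_ofDual.2 h)

/-- The diagram of subrings. -/
def subF {R : Type} [CommRing R] {I : Type} [Preorder I] (T : I → Subring R)
    (hT : ∀ {s s' : I}, s ≤ s' → T s' ≤ T s) : Iᵒᵖ ⥤ CommRingCat.{0} where
  obj s := CommRingCat.of (T s.unop)
  map g := CommRingCat.ofHom (Subring.inclusion (hT (leOfHom g.unop)))
  map_id _ := rfl
  map_comp _ _ := rfl

/-- The cocone over it. -/
def subC {R : Type} [CommRing R] {I : Type} [Preorder I] (T : I → Subring R)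
    (hT : ∀ {s s' : I}, s ≤ s' → T s' ≤ T s) : Cocone (subF T hT) where
  pt := CommRingCat.of R
  ι := { app := fun s => CommRingCat.ofHom (T s.unop).subtype, naturality := fun _ _ _ => rfl }

theorem isPullback_id' {X Y : Scheme.{0}} (w : X ⟶ Y) : IsPullback (𝟙 X) w w (𝟙 Y) :=
  IsPullback.of_horiz_isIso ⟨by simp⟩

theorem claim_ft (U : Scheme.{0}) (a : U ⟶ Spec (CommRingCat.of ℤ)) [LocallyOfFiniteType a]
    [QuasiCompact a] (R : CommRingCat.{0}) (W B : Scheme.{0}) (w₁ : W ⟶ U) (w₂ : W ⟶ Spec R)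
    (j₁ : U ⟶ B) (j₂ : Spec R ⟶ B) (hB : IsGlue w₁ w₂ j₁ j₂) [CompactSpace W] : Good B := by
  classical
  have o₁ := hB.isOpenImmersion_left
  have o₂ := hB.isOpenImmersion_right
  have : CompactSpace U := QuasiCompact.compactSpace_of_compactSpace a
  have : IsLocallyNoetherian U := LocallyOfFiniteType.isLocallyNoetherian a
  have hqW : QuasiSeparatedSpace W := QuasiSeparatedSpace.of_isOpenEmbedding w₁.isOpenEmbedding
  obtain ⟨R, hR⟩ := R
  obtain ⟨ψ₀, hψ₀⟩ : ∃ ψ₀ : CommRingCat.of R ⟶ Γ(W, ⊤), w₂ = W.toSpecΓ ≫ Spec.map ψ₀ :=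
    ⟨_, (toSpecΓ_toΓ w₂).symm⟩
  subst hψ₀
  obtain ⟨κ, hκ, f, hf⟩ := exists_OIData ψ₀ o₂
  have key : ∀ k, ∃ F₀ : Finset R, ∀ R' : Subring R, (∀ x ∈ F₀, x ∈ R') → f k ∈ R' →
      ∀ b : Γ(W, ⊤), ∃ (n : ℕ) (a : R), a ∈ R' ∧ ψ₀ a = ψ₀ (f k) ^ n * b := by
    intro k
    have := finiteType_Γ (w₁ ≫ a) (hf.aff k)
    have hloc : IsLocalization.Away (ψ₀.hom (f k)) Γ(W, W.basicOpen (ψ₀.hom (f k))) :=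
      isLocalization_basicOpen_of_qcqs CompactSpace.isCompact_univ isQuasiSeparated_univ _
    exact exists_finset_surj (G' := Γ(W, W.basicOpen (ψ₀.hom (f k)))) ψ₀.hom (f k) (hf.surj k)
  choose F hF using key
  have := Fintype.ofFinite κ
  let F₀ : Finset R := Finset.univ.biUnion F ∪ Finset.univ.image f
  have hF₀ : ∀ k, ∀ x ∈ F k, x ∈ F₀ := fun k x hx =>
    Finset.mem_union_left _ (Finset.mem_biUnion.2 ⟨k, Finset.mem_univ _, hx⟩)
  have hfF₀ : ∀ k, f k ∈ F₀ := fun k =>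
    Finset.mem_union_right _ (Finset.mem_image_of_mem _ (Finset.mem_univ _))
  clear_value F₀
  have : CategoryTheory.IsConnected (Finset R)ᵒᵈ := { is_nonempty := inferInstance }
  obtain ⟨T, hT, hTF, hTr, hTft⟩ : ∃ (T : (Finset R)ᵒᵈ → Subring R)
      (_ : ∀ {s s' : (Finset R)ᵒᵈ}, s ≤ s' → T s' ≤ T s), (∀ s, ∀ x ∈ F₀, x ∈ T s) ∧
      (∀ r, ∃ s, r ∈ T s) ∧ (∀ s, Algebra.FiniteType ℤ (T s)) :=
    ⟨fun s => clo F₀ s.ofDual, clo_mono' F₀, fun s x hx => subset_clo F₀ hx, 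
      fun r => ⟨OrderDual.toDual {r}, subset_clo' F₀ (Finset.mem_singleton_self _)⟩,
      fun s => finiteType_closure _⟩
  have hOI : ∀ s : (Finset R)ᵒᵈ, OIData W (CommRingCat.ofHom (T s).subtype ≫ ψ₀)
      (fun k => (⟨f k, hTF _ _ (hfF₀ k)⟩ : T s)) := by
    intro s
    refine ⟨hf.cov, hf.aff, ?_, ?_⟩
    · intro k a ⟨n, hn⟩
      obtain ⟨m, hm⟩ := hf.inj k a.1 ⟨n, hn⟩
      exact ⟨m, Subtype.ext hm⟩
    · intro k b
      obtain ⟨n, a, ha, e⟩ := hF k (T s) (fun x hx => hTF _ _ (hF₀ k x hx))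
        (hTF _ _ (hfF₀ k)) b
      exact ⟨n, ⟨a, ha⟩, e⟩
  refine good_glue (I := (Finset R)ᵒᵈ) (t := ⊤) isTerminalTop (U := (Functor.const _).obj U)
    (W := (Functor.const _).obj W) ((Functor.const _).map w₁) (fun _ => o₁) 
    (fun _ => isPullback_id' w₁) (fun _ => by dsimp; infer_instance)
    (fun _ => by dsimp; infer_instance) (fun _ => by dsimp; infer_instance)
    (fun _ => by dsimp; infer_instance) (constCone _ U) (isLimitConstCone _ _)
    (subF T hT) (subC T hT) ?_ ?_ (fun s => CommRingCat.ofHom (T s).subtype ≫ ψ₀)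
    ?_ (fun k => (⟨f k, hTF _ _ (hfF₀ k)⟩ : T ⊤)) hOI ψ₀ hB (fun _ => 𝟙 W)
    (fun _ => isPullback_id' w₁) ?_ hf ?_
  · intro r
    obtain ⟨s, hs⟩ := hTr r
    exact ⟨s, ⟨r, hs⟩, rfl⟩
  · intro s x y h
    exact ⟨s, 𝟙 _, congrArg _ (Subtype.ext h)⟩
  · intro i j g
    simp
    rfl
  · intro i
    simp
    rfl
  · intro i P k₁ k₂ h
    have inst : IsZariskiLocalAtSource (@LocallyOfFiniteType : MorphismProperty Scheme.{0}) :=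
      HasRingHomProperty.instIsZariskiLocalAtSource (Q := RingHom.FiniteType)
    refine Good.ofFT P (specZIsTerminal.from _) (h.of_source @LocallyOfFiniteType _ ?_ ?_) ?_
    · have : k₁ ≫ specZIsTerminal.from P = a := specZIsTerminal.hom_ext _ _
      rw [this]; infer_instance
    · exact locallyOfFiniteType_specMap (hTft i) _
    · have : CompactSpace P := by
        have : CompactSpace (((Functor.const (Finset R)ᵒᵈ).obj U).obj i) := inferInstanceAs (CompactSpace U)
        exact h.compactSpace
      infer_instance

end ModelProof

namespace ModelProof
open Opposite

theorem pow_aux {A R : Type*} [CommRing A] [CommRing R] (φ : A →+* R) (x a : A) (m n : ℕ)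
    (hm : φ x ^ m * φ a = 0) : φ (x ^ (m + n) * a) = φ 0 := by
  rw [map_mul, map_pow, pow_add, mul_right_comm, hm, zero_mul, map_zero]

section Fib

variable {J : Type} [SmallCategory J] (G : J ⥤ CommRingCat.{0}) (c : Cocone G)
  {R : CommRingCat.{0}} (ψ₀ : R ⟶ c.pt)

/-- The fibre product of `R` and `G j` over the point of a cocone. -/
def fibObj (j : J) : Subring (R × G.obj j) :=
  RingHom.eqLocus (ψ₀.hom.comp (RingHom.fst R (G.obj j)))
    ((c.ι.app j).hom.comp (RingHom.snd R (G.obj j)))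

theorem mem_fibObj {j : J} (x : R × G.obj j) :
    x ∈ fibObj G c ψ₀ j ↔ ψ₀ x.1 = c.ι.app j x.2 := Iff.rfl

theorem cocone_w_apply {i j : J} (g : i ⟶ j) (x : G.obj i) :
    c.ι.app j (G.map g x) = c.ι.app i x := by
  rw [← ConcreteCategory.comp_apply, c.w]

/-- Transition maps for the fibre product functor. -/
def fibMap {i j : J} (g : i ⟶ j) : fibObj G c ψ₀ i →+* fibObj G c ψ₀ j :=
  ((RingHom.prodMap (RingHom.id R) (G.map g).hom).comp (fibObj G c ψ₀ i).subtype).codRestrict _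
    (fun x => by
      have := (mem_fibObj G c ψ₀ x.1).1 x.2
      exact (mem_fibObj G c ψ₀ _).2 (this.trans (cocone_w_apply G c g _).symm))

/-- The fibre product functor. -/
def fibF : J ⥤ CommRingCat.{0} where
  obj j := CommRingCat.of (fibObj G c ψ₀ j)
  map g := CommRingCat.ofHom (fibMap G c ψ₀ g)
  map_id j := by
    refine CommRingCat.hom_ext (RingHom.ext fun x => Subtype.ext (Prod.ext rfl ?_))
    change G.map (𝟙 j) x.1.2 = x.1.2
    simp
  map_comp f g := by
    refine CommRingCat.hom_ext (RingHom.ext fun x => Subtype.ext (Prod.ext rfl ?_))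
    change G.map (f ≫ g) x.1.2 = G.map g (G.map f x.1.2)
    simp

/-- The second projection. -/
def fibSnd (j : J) : (fibF G c ψ₀).obj j ⟶ G.obj j :=
  CommRingCat.ofHom ((RingHom.snd _ _).comp (fibObj G c ψ₀ j).subtype)

/-- The cocone of first projections. -/
def fibC : Cocone (fibF G c ψ₀) where
  pt := R
  ι :=
    { app := fun j => CommRingCat.ofHom ((RingHom.fst _ _).comp (fibObj G c ψ₀ j).subtype)
      naturality := fun _ _ _ => rfl }

theorem fib_mk {j : J} (r : R) (b : G.obj j) (h : ψ₀ r = c.ι.app j b) :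
    ∃ x : (fibF G c ψ₀).obj j, (fibC G c ψ₀).ι.app j x = r ∧ fibSnd G c ψ₀ j x = b :=
  ⟨⟨(r, b), h⟩, rfl, rfl⟩

theorem fib_ext {j : J} (x y : (fibF G c ψ₀).obj j)
    (h₁ : (fibC G c ψ₀).ι.app j x = (fibC G c ψ₀).ι.app j y)
    (h₂ : fibSnd G c ψ₀ j x = fibSnd G c ψ₀ j y) : x = y :=
  Subtype.ext (Prod.ext h₁ h₂)

theorem fib_w (j : J) : (fibC G c ψ₀).ι.app j ≫ ψ₀ = fibSnd G c ψ₀ j ≫ c.ι.app j := by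
  ext x
  exact x.2

theorem fib_nat {i j : J} (g : i ⟶ j) :
    (fibF G c ψ₀).map g ≫ fibSnd G c ψ₀ j = fibSnd G c ψ₀ i ≫ G.map g := rfl

theorem fib_surj (hs : ∀ r : c.pt, ∃ (i : J) (x : G.obj i), c.ι.app i x = r) (r : R) :
    ∃ (i : J) (x : (fibF G c ψ₀).obj i), (fibC G c ψ₀).ι.app i x = r := by
  obtain ⟨i, b, hb⟩ := hs (ψ₀ r)
  obtain ⟨x, hx, -⟩ := fib_mk G c ψ₀ r b hb.symm
  exact ⟨i, x, hx⟩

theorem fib_inj (hi : ∀ (i : J) (x y : G.obj i), c.ι.app i x = c.ι.app i y → ∃ (k : J) (f : i ⟶ k),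
      G.map f x = G.map f y) (i : J) (x y : (fibF G c ψ₀).obj i)
      (h : (fibC G c ψ₀).ι.app i x = (fibC G c ψ₀).ι.app i y) :
      ∃ (k : J) (f : i ⟶ k), (fibF G c ψ₀).map f x = (fibF G c ψ₀).map f y := by
  have h2 : c.ι.app i (fibSnd G c ψ₀ i x) = c.ι.app i (fibSnd G c ψ₀ i y) := by
    have hx := x.2
    have hy := y.2
    rw [mem_fibObj] at hx hy
    exact hx.symm.trans ((congrArg ψ₀ h).trans hy)
  obtain ⟨k, f, hf⟩ := hi i _ _ h2
  exact ⟨k, f, fib_ext G c ψ₀ _ _ h hf⟩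

theorem fib_wa (j : J) (x : (fibF G c ψ₀).obj j) :
    ψ₀ ((fibC G c ψ₀).ι.app j x) = c.ι.app j (fibSnd G c ψ₀ j x) :=
  x.2

theorem fib_oi_inj {f : R}
    (hf : ∀ a : R, (∃ n : ℕ, ψ₀ f ^ n * ψ₀ a = 0) → ∃ m : ℕ, f ^ m * a = 0)
    {j : J} (x : (fibF G c ψ₀).obj j) (hx : (fibC G c ψ₀).ι.app j x = f)
    (a : (fibF G c ψ₀).obj j) (ha : ∃ n : ℕ, fibSnd G c ψ₀ j x ^ n * fibSnd G c ψ₀ j a = 0) :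
    ∃ m : ℕ, x ^ m * a = 0 := by
  obtain ⟨n, hn⟩ := ha
  have h0 := congrArg (c.ι.app j) hn
  rw [map_mul, map_pow, map_zero, ← fib_wa, ← fib_wa, hx] at h0
  obtain ⟨m, hm⟩ := hf ((fibC G c ψ₀).ι.app j a) ⟨n, h0⟩
  refine ⟨m + n, fib_ext G c ψ₀ _ _ ?_ ?_⟩
  · subst hx
    exact pow_aux ((RingHom.fst _ _).comp (fibObj G c ψ₀ j).subtype) x a m n hm
  · rw [map_mul, map_pow, map_zero, pow_add, mul_assoc, hn, mul_zero]

theorem fib_oi_surj {f : R} (hf : ∀ b : c.pt, ∃ (n : ℕ) (a : R), ψ₀ a = ψ₀ f ^ n * b)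
    {j : J} (x : (fibF G c ψ₀).obj j) (hx : (fibC G c ψ₀).ι.app j x = f) (b : G.obj j) :
    ∃ (n : ℕ) (a : (fibF G c ψ₀).obj j), fibSnd G c ψ₀ j a = fibSnd G c ψ₀ j x ^ n * b := by
  obtain ⟨n, a, ha⟩ := hf (c.ι.app j b)
  obtain ⟨y, -, hy⟩ := fib_mk G c ψ₀ (j := j) a (fibSnd G c ψ₀ j x ^ n * b) (by
    rw [map_mul, map_pow, ← fib_wa, hx, ha])
  exact ⟨n, y, hy⟩

end Fib

theorem claim_stepA {I : Type} [SmallCategory I] [IsCofiltered I] {t : I} (ht : IsTerminal t)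
    {U W : I ⥤ Scheme.{0}} (w₁ : W ⟶ U) (hw₁ : ∀ i, IsOpenImmersion (w₁.app i))
    (e₁ : ∀ {i i' : I} (f : i ⟶ i'), IsPullback (W.map f) (w₁.app i) (w₁.app i') (U.map f))
    (aU : ∀ {i i' : I} (f : i ⟶ i'), IsAffineHom (U.map f))
    (hUc : ∀ i, CompactSpace (U.obj i)) (hUq : ∀ i, QuasiSeparatedSpace (U.obj i))
    (hWc : ∀ i, CompactSpace (W.obj i))
    (cU : Cone U) (hU : IsLimit cU) (cW : Cone W) (hW : IsLimit cW)
    {B : Scheme.{0}} {a₁ : cW.pt ⟶ cU.pt}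
    (p₁ : ∀ i, IsPullback (cW.π.app i) a₁ (w₁.app i) (cU.π.app i))
    {R : CommRingCat.{0}} (ψ₀ : R ⟶ Γ(cW.pt, ⊤))
    {j₁ : cU.pt ⟶ B} {j₂ : Spec R ⟶ B} (hB : IsGlue a₁ (cW.pt.toSpecΓ ≫ Spec.map ψ₀) j₁ j₂)
    {κ : Type} (f : κ → R) (hf₀ : OIData cW.pt ψ₀ f)
    (h : κ → Γ(W.obj t, ⊤)) (hh : ∀ k, ψ₀ (f k) = (cW.π.app t).appTop (h k))
    (hcov : ⨆ k, (W.obj t).basicOpen (h k) = ⊤)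
    (haff : ∀ k, IsAffineOpen ((W.obj t).basicOpen (h k)))
    (hG : ∀ i (R : CommRingCat.{0}) (P : Scheme.{0}) (w₂ : W.obj i ⟶ Spec R)
      (k₁ : U.obj i ⟶ P) (k₂ : Spec R ⟶ P),
      IsGlue (w₁.app i) w₂ k₁ k₂ → Good P) : Good B := by
  have aW : ∀ {i i' : I} (f : i ⟶ i'), IsAffineHom (W.map f) := fun {i i'} f => by
    have := aU f
    exact MorphismProperty.of_isPullback (P := @IsAffineHom) (e₁ f).flip this
  have hWq : ∀ i, QuasiSeparatedSpace (W.obj i) := fun i =>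
    QuasiSeparatedSpace.of_isOpenEmbedding (w₁.app i).isOpenEmbedding
  have : CompactSpace cW.pt := Scheme.compactSpace_of_isLimit W cW hW
  let G : Iᵒᵖ ⥤ CommRingCat.{0} := W.op ⋙ Scheme.Γ
  let c : Cocone G := Scheme.Γ.mapCocone cW.op
  have hcι : ∀ i, c.ι.app (op i) = (cW.π.app i).appTop := fun i => rfl
  have hGm : ∀ {i j} (g : i ⟶ j), G.map g.op = (W.map g).appTop := fun g => rfl
  have hs : ∀ r : c.pt, ∃ (i : Iᵒᵖ) (x : G.obj i), c.ι.app i x = r := by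
    intro r
    obtain ⟨i, x, hx⟩ := exists_appTop_π_eq_of_isLimit W cW hW r
    exact ⟨op i, x, hx.symm⟩
  have hi : ∀ (i : Iᵒᵖ) (x y : G.obj i), c.ι.app i x = c.ι.app i y → ∃ (k : Iᵒᵖ) (f : i ⟶ k),
      G.map f x = G.map f y := by
    intro i x y hxy
    obtain ⟨k, f, hf⟩ := exists_app_map_eq_map_of_isLimit W cW hW (i := i.unop) (U := ⊤)
      isCompact_univ x y hxy
    exact ⟨op k, f.op, hf⟩
  choose F hF₁ hF₂ using fun k => fib_mk G c ψ₀ (j := op t) (f k) (h k) (hh k)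
  have hFn : ∀ i k, fibSnd G c ψ₀ (op i) ((fibF G c ψ₀).map (ht.from i).op (F k)) =
      (W.map (ht.from i)).appTop (h k) := by
    intro i k
    rw [← hF₂ k]
    exact congr($(fib_nat G c ψ₀ (ht.from i).op) (F k))
  have hFι : ∀ i k, (fibC G c ψ₀).ι.app (op i) ((fibF G c ψ₀).map (ht.from i).op (F k)) =
      f k := by
    intro i k
    rw [← hF₁ k]
    exact cocone_w_apply _ (fibC G c ψ₀) _ _
  have hwa : ∀ i x, ψ₀ ((fibC G c ψ₀).ι.app (op i) x) = c.ι.app (op i) (fibSnd G c ψ₀ (op i) x) :=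
    fun i x => congr($(fib_w G c ψ₀ (op i)) x)
  refine good_glue ht w₁ hw₁ e₁ aU hUc hUq hWc cU hU (fibF G c ψ₀) (fibC G c ψ₀) ?_ ?_
    (fun i => fibSnd G c ψ₀ (op i)) (fun g => fib_nat G c ψ₀ g.op) F ?_ (W₀ := cW.pt) ψ₀ hB
    (fun i => cW.π.app i) p₁ (fun i => fib_w G c ψ₀ (op i)) ?_
    (fun i P k₁ k₂ => hG i _ P _ k₁ k₂)
  · intro r
    obtain ⟨i, x, hx⟩ := fib_surj G c ψ₀ hs r
    exact ⟨i.unop, x, hx⟩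
  · intro i x y hxy
    obtain ⟨k, f, hf⟩ := fib_inj G c ψ₀ hi _ x y hxy
    exact ⟨k.unop, f.unop, hf⟩
  · intro i
    have hb : ∀ k, (W.obj i).basicOpen (fibSnd G c ψ₀ (op i) ((fibF G c ψ₀).map (ht.from i).op (F k))) =
        W.map (ht.from i) ⁻¹ᵁ (W.obj t).basicOpen (h k) := by
      intro k
      rw [hFn i k]
      exact (Scheme.preimage_basicOpen_top _ _).symm
    refine ⟨?_, ?_, ?_, ?_⟩
    · refine (iSup_congr hb).trans ?_
      rw [← Scheme.Hom.preimage_iSup, hcov]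
      rfl
    · intro k
      have := aW (ht.from i)
      have q := (haff k).preimage (W.map (ht.from i))
      rw [← hb k] at q
      exact q
    · exact fun k => fib_oi_inj G c ψ₀ (hf₀.inj k) _ (hFι i k)
    · exact fun k => fib_oi_surj G c ψ₀ (hf₀.surj k) _ (hFι i k)
  · have : (fun k => (fibC G c ψ₀).ι.app (op t) (F k)) = f := funext hF₁
    rw [this]
    exact hf₀

end ModelProof

namespace ModelProof
open Opposite

theorem exists_min {I : Type} [SmallCategory I] [IsCofiltered I] {κ : Type} [Finite κ] (i : κ → I) :
    ∃ j : I, Nonempty (∀ k, j ⟶ i k) := by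
  classical
  have := Fintype.ofFinite κ
  obtain ⟨j, hj⟩ := IsCofiltered.inf_objs_exists (Finset.univ.image i)
  exact ⟨j, ⟨fun k => (hj (Finset.mem_image_of_mem _ (Finset.mem_univ _))).some⟩⟩

theorem exists_min' {I : Type} [SmallCategory I] [IsCofiltered I] {κ : Type} [Finite κ] {i₀ : I}
    (i : κ → I) (g : ∀ k, i k ⟶ i₀) :
    ∃ (j : I) (h : j ⟶ i₀) (f : ∀ k, j ⟶ i k), ∀ k, f k ≫ g k = h := by
  obtain ⟨j, ⟨f⟩⟩ := exists_min (I := Over i₀) (fun k => Over.mk (g k))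
  exact ⟨j.left, j.hom, fun k => (f k).left, fun k => Over.w (f k)⟩

theorem claim_stepB {I : Type} [SmallCategory I] [IsCofiltered I]
    {U W : I ⥤ Scheme.{0}} (w₁ : W ⟶ U) (hw₁ : ∀ i, IsOpenImmersion (w₁.app i))
    (e₁ : ∀ {i i' : I} (f : i ⟶ i'), IsPullback (W.map f) (w₁.app i) (w₁.app i') (U.map f))
    (aU : ∀ {i i' : I} (f : i ⟶ i'), IsAffineHom (U.map f))
    (hUc : ∀ i, CompactSpace (U.obj i)) (hUq : ∀ i, QuasiSeparatedSpace (U.obj i))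
    (hWc : ∀ i, CompactSpace (W.obj i))
    (cU : Cone U) (hU : IsLimit cU) (cW : Cone W) (hW : IsLimit cW)
    {B : Scheme.{0}} {a₁ : cW.pt ⟶ cU.pt}
    (p₁ : ∀ i, IsPullback (cW.π.app i) a₁ (w₁.app i) (cU.π.app i))
    {R : CommRingCat.{0}} (w₂ : cW.pt ⟶ Spec R)
    {j₁ : cU.pt ⟶ B} {j₂ : Spec R ⟶ B} (hB : IsGlue a₁ w₂ j₁ j₂)
    (hG : ∀ i (R : CommRingCat.{0}) (P : Scheme.{0}) (w₂ : W.obj i ⟶ Spec R)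
      (k₁ : U.obj i ⟶ P) (k₂ : Spec R ⟶ P),
      IsGlue (w₁.app i) w₂ k₁ k₂ → Good P) : Good B := by
  have aW : ∀ {i i' : I} (f : i ⟶ i'), IsAffineHom (W.map f) := fun {i i'} f => by
    have := aU f
    exact MorphismProperty.of_isPullback (P := @IsAffineHom) (e₁ f).flip this
  have hWq : ∀ i, QuasiSeparatedSpace (W.obj i) := fun i =>
    QuasiSeparatedSpace.of_isOpenEmbedding (w₁.app i).isOpenEmbedding
  have : CompactSpace cW.pt := Scheme.compactSpace_of_isLimit W cW hW
  obtain ⟨ψ₀, hψ₀⟩ : ∃ ψ₀ : R ⟶ Γ(cW.pt, ⊤), w₂ = cW.pt.toSpecΓ ≫ Spec.map ψ₀ :=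
    ⟨_, (toSpecΓ_toΓ w₂).symm⟩
  subst hψ₀
  obtain ⟨κ, hκ, f, hf⟩ := exists_OIData ψ₀ hB.isOpenImmersion_right
  choose i₀ x₀ hx₀ using fun k => exists_appTop_π_eq_of_isLimit W cW hW (ψ₀ (f k))
  obtain ⟨i₁, ⟨g₁⟩⟩ := exists_min i₀
  obtain ⟨h₁, hh₁⟩ : ∃ h : κ → Γ(W.obj i₁, ⊤), ∀ k, ψ₀ (f k) = (cW.π.app i₁).appTop (h k) := by
    refine ⟨fun k => (W.map (g₁ k)).appTop (x₀ k), fun k => ?_⟩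
    rw [hx₀, ← ConcreteCategory.comp_apply, ← Scheme.Hom.comp_appTop, cW.w]
  have hcov₁ : cW.π.app i₁ ⁻¹ᵁ (⨆ k, (W.obj i₁).basicOpen (h₁ k)) = ⊤ := by
    rw [Scheme.Hom.preimage_iSup, ← hf.cov]
    refine iSup_congr fun k => ?_
    rw [hh₁ k]
    exact (Scheme.preimage_basicOpen_top _ _)
  obtain ⟨i₂, g₂, hg₂⟩ := exists_map_eq_top W cW hW _ hcov₁
  have key : ∀ k, ∃ (i : I) (g : i ⟶ i₂),
      IsAffineOpen (W.map g ⁻¹ᵁ (W.map g₂ ⁻¹ᵁ (W.obj i₁).basicOpen (h₁ k))) := by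
    intro k
    have hc : IsCompact ((W.map g₂ ⁻¹ᵁ (W.obj i₁).basicOpen (h₁ k) : (W.obj i₂).Opens) : Set (W.obj i₂)) := by
      have : IsCompact (((W.obj i₁).basicOpen (h₁ k)  : (W.obj i₁).Opens) : Set (W.obj i₁)) :=
        isCompact_basicOpen _ isCompact_univ _
      exact (W.map g₂).isCompact_preimage this
    have h1 (j : Over i₂) : CompactSpace ((opensDiagram W i₂ (W.map g₂ ⁻¹ᵁ (W.obj i₁).basicOpen (h₁ k))).obj j) :=
      isCompact_iff_compactSpace.mp ((W.map j.hom).isCompact_preimage hc)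
    have h2 (j : Over i₂) : QuasiSeparatedSpace ((opensDiagram W i₂ (W.map g₂ ⁻¹ᵁ (W.obj i₁).basicOpen (h₁ k))).obj j) :=
      have : QuasiSeparatedSpace ↥((Over.forget i₂ ⋙ W).obj j) := hWq j.left
      QuasiSeparatedSpace.of_isOpenEmbedding ((opensDiagramι W i₂ (W.map g₂ ⁻¹ᵁ (W.obj i₁).basicOpen (h₁ k))).app j).isOpenEmbedding
    have h3 : IsAffine (opensCone W cW i₂ (W.map g₂ ⁻¹ᵁ (W.obj i₁).basicOpen (h₁ k))).pt := by
      have : cW.π.app i₂ ⁻¹ᵁ (W.map g₂ ⁻¹ᵁ (W.obj i₁).basicOpen (h₁ k)) = cW.pt.basicOpen (ψ₀ (f k)) := by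
        rw [← Scheme.Hom.comp_preimage, cW.w, hh₁]
        exact (Scheme.preimage_basicOpen_top _ _)
      have h4 := hf.aff k
      rw [← this] at h4
      exact h4
    obtain ⟨j, hj⟩ := Scheme.exists_isAffine_of_isLimit _ _ 
      (isLimitOpensCone W cW hW i₂ (W.map g₂ ⁻¹ᵁ (W.obj i₁).basicOpen (h₁ k)))
    exact ⟨j.left, j.hom, hj⟩
  choose i₃ g₃ ha₃ using key
  obtain ⟨i, g, g', hg⟩ := exists_min' i₃ g₃
  let h : κ → Γ(W.obj i, ⊤) := fun k => (W.map (g ≫ g₂)).appTop (h₁ k)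
  have hb : ∀ k, (W.obj i).basicOpen (h k) = W.map g ⁻¹ᵁ W.map g₂ ⁻¹ᵁ (W.obj i₁).basicOpen (h₁ k) := by
    intro k
    rw [← Scheme.Hom.comp_preimage, ← W.map_comp]
    exact (Scheme.preimage_basicOpen_top _ _).symm
  refine claim_stepA (I := Over i) (t := Over.mk (𝟙 i)) Over.mkIdTerminal
    (U := Over.forget i ⋙ U) (W := Over.forget i ⋙ W) (Functor.whiskerLeft _ w₁) (fun j => hw₁ j.left)
    (fun g => e₁ g.left) (fun g => aU g.left) (fun j => hUc j.left) (fun j => hUq j.left)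
    (fun j => hWc j.left) (cU.whisker (Over.forget i)) 
    ((Functor.Initial.isLimitWhiskerEquiv (Over.forget i) cU).symm hU)
    (cW.whisker (Over.forget i)) 
    ((Functor.Initial.isLimitWhiskerEquiv (Over.forget i) cW).symm hW) (fun j => p₁ j.left)
    ψ₀ hB f hf h ?_ ?_ ?_ (fun j => hG j.left)
  · intro k
    refine (hh₁ k).trans ?_
    change _ = (cW.π.app i).appTop (h k)
    simp only [h]
    rw [← ConcreteCategory.comp_apply, ← Scheme.Hom.comp_appTop, cW.w]
  · refine (iSup_congr hb).trans ?_
    rw [← Scheme.Hom.preimage_iSup, ← Scheme.Hom.preimage_iSup, hg₂]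
    rfl
  · intro k
    have := aW (g' k)
    have q := (ha₃ k).preimage (W.map (g' k))
    rw [← Scheme.Hom.comp_preimage, ← W.map_comp, hg, ← hb] at q
    exact q

end ModelProof

namespace ModelProof
open Opposite

theorem Good.compact_qs {B : Scheme.{0}} (h : Good B) : CompactSpace B ∧ QuasiSeparatedSpace B := by
  induction h with
  | ofFT B a h₁ h₂ =>
    have : IsLocallyNoetherian B := LocallyOfFiniteType.isLocallyNoetherian a
    exact ⟨QuasiCompact.compactSpace_of_compactSpace a, inferInstance⟩
  | @lim I _ _ D c hc haff hcpt hqs _ ih =>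
    refine ⟨Scheme.compactSpace_of_isLimit D c hc, ?_⟩
    obtain ⟨i⟩ := IsCofiltered.nonempty (C := I)
    have := isAffineHom_π_app D c hc i
    exact quasiSeparatedSpace_of_quasiSeparated (c.π.app i)

theorem IsGlue.precomp_iso {W W' U V P : Scheme.{0}} {w₁ : W ⟶ U} {w₂ : W ⟶ V} {j₁ : U ⟶ P}
    {j₂ : V ⟶ P} (h : IsGlue w₁ w₂ j₁ j₂) (e : W' ≅ W) :
    IsGlue (e.hom ≫ w₁) (e.hom ≫ w₂) j₁ j₂ where
  o₁ := h.o₁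
  o₂ := h.o₂
  cov := h.cov
  pb := h.pb.of_iso e.symm (Iso.refl _) (Iso.refl _) (Iso.refl _) (by simp) (by simp) (by simp) (by simp)

theorem claim {U : Scheme.{0}} (hU : Good U) : ∀ (R : CommRingCat.{0}) (W B : Scheme.{0}) (w₁ : W ⟶ U)
    (w₂ : W ⟶ Spec R) (j₁ : U ⟶ B) (j₂ : Spec R ⟶ B), IsGlue w₁ w₂ j₁ j₂ → CompactSpace W →
    Good B := by
  induction hU with
  | ofFT U a h₁ h₂ =>
    intro R W B w₁ w₂ j₁ j₂ hB hW
    exact claim_ft U a R W B w₁ w₂ j₁ j₂ hB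
  | @lim I _ _ D c hc haff hcpt hqs _ ih =>
    intro R W B w₁ w₂ j₁ j₂ hB hW
    have o₁ := hB.isOpenImmersion_left
    obtain ⟨i, V, hV, e⟩ := exists_preimage_eq D c hc w₁.opensRange (isCompact_range w₁.continuous)
    let ε : (c.π.app i ⁻¹ᵁ V).toScheme ≅ W := IsOpenImmersion.isoOfRangeEq (c.π.app i ⁻¹ᵁ V).ι w₁ (by
      rw [Scheme.Opens.range_ι, e]; rfl)
    have hε : ε.hom ≫ w₁ = (c.π.app i ⁻¹ᵁ V).ι := IsOpenImmersion.isoOfRangeEq_hom_fac _ _ _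
    have hB' := hB.precomp_iso ε
    rw [hε] at hB'
    have hWc : ∀ j : Over i, CompactSpace ((opensDiagram D i V).obj j) := fun j =>
      isCompact_iff_compactSpace.mp ((D.map j.hom).isCompact_preimage hV)
    refine claim_stepB (I := Over i) (opensDiagramι D i V) (fun j => inferInstance) ?_
      (fun g => haff g.left) (fun j => hcpt j.left) (fun j => hqs j.left) hWc
      (c.whisker (Over.forget i)) ((Functor.Initial.isLimitWhiskerEquiv (Over.forget i) c).symm hc)
      (opensCone D c i V) (isLimitOpensCone D c hc i V) ?_ (ε.hom ≫ w₂) hB' 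
      (fun j R P w₂ k₁ k₂ h => ih j.left R _ P _ w₂ k₁ k₂ h (hWc j))
    · intro j j' g
      refine IsOpenImmersion.isPullback _ _ _ _ ?_ ?_
      · exact ((opensDiagramι D i V).naturality g).symm
      · have h1 : ((opensDiagramι D i V).app j).opensRange = D.map j.hom ⁻¹ᵁ V :=
          Scheme.Opens.opensRange_ι (D.map j.hom ⁻¹ᵁ V)
        have h2 : ((opensDiagramι D i V).app j').opensRange = D.map j'.hom ⁻¹ᵁ V :=
          Scheme.Opens.opensRange_ι (D.map j'.hom ⁻¹ᵁ V)
        rw [h1, h2]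
        change (D.map g.left) ⁻¹ᵁ _ = _
        rw [← Scheme.Hom.comp_preimage, ← D.map_comp, Over.w]
    · intro j
      have h1 : (c.π.app i ⁻¹ᵁ V).ι.opensRange = c.π.app i ⁻¹ᵁ V :=
        Scheme.Opens.opensRange_ι _
      have h2 : ((opensDiagramι D i V).app j).opensRange = D.map j.hom ⁻¹ᵁ V :=
        Scheme.Opens.opensRange_ι (D.map j.hom ⁻¹ᵁ V)
      have hle : c.π.app i ⁻¹ᵁ V ≤ c.π.app j.left ⁻¹ᵁ D.map j.hom ⁻¹ᵁ V := by
        rw [← Scheme.Hom.comp_preimage, c.w]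
      have := IsOpenImmersion.isPullback ((c.π.app j.left).resLE (D.map j.hom ⁻¹ᵁ V) (c.π.app i ⁻¹ᵁ V) hle)
        (c.π.app i ⁻¹ᵁ V).ι (D.map j.hom ⁻¹ᵁ V).ι (c.π.app j.left) 
        (Scheme.Hom.resLE_comp_ι (c.π.app j.left) (U := D.map j.hom ⁻¹ᵁ V) (V := c.π.app i ⁻¹ᵁ V) _).symm
        (by rw [Scheme.Opens.opensRange_ι, Scheme.Opens.opensRange_ι, ← Scheme.Hom.comp_preimage, c.w])
      exact this

theorem IsGlue.postcomp_iso {W U V V' P : Scheme.{0}} {w₁ : W ⟶ U} {w₂ : W ⟶ V} {j₁ : U ⟶ P}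
    {j₂ : V ⟶ P} (h : IsGlue w₁ w₂ j₁ j₂) (e : V ≅ V') :
    IsGlue w₁ (w₂ ≫ e.hom) j₁ (e.inv ≫ j₂) where
  o₁ := h.o₁
  o₂ := have := h.o₂; inferInstance
  cov := fun p => (h.cov p).imp id fun ⟨v, hv⟩ => ⟨e.hom v, by
    rw [← Scheme.Hom.comp_apply, e.hom_inv_id_assoc, hv]⟩
  pb := h.pb.of_iso (Iso.refl _) (Iso.refl _) e (Iso.refl _) (by simp) (by simp) (by simp) (by simp)

theorem homOfLE_ι_apply {X : Scheme.{0}} {U V : X.Opens} (h : U ≤ V) (x : U.toScheme) :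
    V.ι (X.homOfLE h x) = U.ι x := by
  rw [← Scheme.Hom.comp_apply, Scheme.homOfLE_ι]

theorem isGlue_opens_sup {X : Scheme.{0}} (U V : X.Opens) :
    IsGlue (X.homOfLE (inf_le_left : U ⊓ V ≤ U)) (X.homOfLE (inf_le_right : U ⊓ V ≤ V))
      (X.homOfLE (le_sup_left : U ≤ U ⊔ V)) (X.homOfLE (le_sup_right : V ≤ U ⊔ V)) :=
  ⟨inferInstance, inferInstance, isPullback_opens_inf_le _ _, fun p => by
    have key : p.1 ∈ U ⊔ V := p.2
    rcases key with hp | hp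
    · refine Or.inl ⟨⟨p.1, hp⟩, ?_⟩
      apply (U ⊔ V).ι.isOpenEmbedding.injective
      exact homOfLE_ι_apply _ _
    · refine Or.inr ⟨⟨p.1, hp⟩, ?_⟩
      apply (U ⊔ V).ι.isOpenEmbedding.injective
      exact homOfLE_ι_apply _ _⟩

theorem good_of_isEmpty (X : Scheme.{0}) [IsEmpty X] : Good X :=
  Good.ofFT X (specZIsTerminal.from X) inferInstance inferInstance

theorem good_of_iso {X Y : Scheme.{0}} (e : X ≅ Y) (h : Good X) : Good Y := by
  have hc := h.compact_qs
  have := hc.1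
  have := hc.2
  refine Good.lim (I := Discrete PUnit) ((Functor.const _).obj X) ⟨Y, (Functor.const _).map e.inv⟩ ?_
    (fun _ => by dsimp; infer_instance) (fun _ => by dsimp; infer_instance)
    (fun _ => by dsimp; infer_instance) (fun _ => by dsimp; exact h)
  refine ⟨fun s => s.π.app ⟨⟨⟩⟩ ≫ e.hom, ?_, ?_⟩
  · rintro s ⟨⟨⟩⟩
    simp
  · intro s m hm
    rw [← hm ⟨⟨⟩⟩]
    simp

theorem good_of_qcqs (X : Scheme.{0}) [CompactSpace X] [QuasiSeparatedSpace X] : Good X := by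
  have key : Good (⊤ : X.Opens).toScheme := by
    refine compact_open_induction_on (P := fun S : X.Opens => Good S.toScheme) ⊤ isCompact_univ ?_ ?_
    · have : IsEmpty (⊥ : X.Opens).toScheme := ⟨fun x => x.2⟩
      exact good_of_isEmpty _
    · intro S hS U h
      have hg := (isGlue_opens_sup S U.1).postcomp_iso U.2.isoSpec
      refine claim h _ _ _ _ _ _ _ hg ?_
      exact isCompact_iff_compactSpace.mp
        (QuasiSeparatedSpace.inter_isCompact _ _ S.2 hS U.1.2 U.2.isCompact)
  exact good_of_iso X.topIso key

end ModelProof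

namespace ModelProof
open Opposite

section BC

variable {I : Type} [SmallCategory I] (D : I ⥤ Scheme.{0}) {i : I} {A : Scheme.{0}}
  (a : A ⟶ D.obj i)

/-- Base change of `A`, transition maps. -/
noncomputable def bcMap {f f' : Over i} (g : f ⟶ f') :
    pullback a (D.map f.hom) ⟶ pullback a (D.map f'.hom) :=
  pullback.lift (pullback.fst _ _) (pullback.snd _ _ ≫ D.map g.left) (by
    rw [pullback.condition, Category.assoc, ← D.map_comp, Over.w])

@[simp]
theorem bcMap_fst {f f' : Over i} (g : f ⟶ f') :
    bcMap D a g ≫ pullback.fst a (D.map f'.hom) = pullback.fst a (D.map f.hom) :=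
  pullback.lift_fst _ _ _

@[simp]
theorem bcMap_snd {f f' : Over i} (g : f ⟶ f') :
    bcMap D a g ≫ pullback.snd a (D.map f'.hom) = pullback.snd a (D.map f.hom) ≫ D.map g.left :=
  pullback.lift_snd _ _ _

theorem bcMap_isPullback {f f' : Over i} (g : f ⟶ f') :
    IsPullback (bcMap D a g) (pullback.snd a (D.map f.hom)) (pullback.snd a (D.map f'.hom))
      (D.map g.left) := by
  refine IsPullback.of_right (h₁₂ := pullback.fst a (D.map f'.hom)) (v₁₃ := a) (h₂₂ := D.map f'.hom) ?_ (bcMap_snd D a g)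
    (IsPullback.of_hasPullback _ _)
  rw [bcMap_fst, ← D.map_comp, Over.w]
  exact IsPullback.of_hasPullback _ _

/-- Base change of `A` along the diagram. -/
noncomputable def bcF : Over i ⥤ Scheme.{0} where
  obj f := pullback a (D.map f.hom)
  map {f f'} g := bcMap D a g
  map_id f := by
    apply pullback.hom_ext
    · rw [bcMap_fst, Category.id_comp]
    · rw [bcMap_snd, Category.id_comp]
      change _ ≫ D.map (𝟙 _) = _
      rw [D.map_id, Category.comp_id]
  map_comp f g := by
    apply pullback.hom_ext
    · rw [bcMap_fst, Category.assoc, bcMap_fst, bcMap_fst]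
    · rw [bcMap_snd, Category.assoc, bcMap_snd, ← Category.assoc, bcMap_snd]
      change _ ≫ D.map (_ ≫ _) = _
      rw [D.map_comp, Category.assoc]

/-- Projection to the base. -/
noncomputable def bcSnd : bcF D a ⟶ Over.forget i ⋙ D where
  app f := pullback.snd a (D.map f.hom)
  naturality _ _ g := bcMap_snd D a g

variable (c : Cone D) {W : Scheme.{0}} {ω : W ⟶ A} {x : W ⟶ c.pt} 
  (h : IsPullback ω x a (c.π.app i))

/-- map to the base change -/
noncomputable def bcLift {j : I} (f : j ⟶ i) : W ⟶ pullback a (D.map f) :=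
  pullback.lift ω (x ≫ c.π.app j) (by rw [h.w, Category.assoc, c.w])

@[simp]
theorem bcLift_fst {j : I} (f : j ⟶ i) : bcLift D a c h f ≫ pullback.fst _ _ = ω :=
  pullback.lift_fst _ _ _

@[simp]
theorem bcLift_snd {j : I} (f : j ⟶ i) : bcLift D a c h f ≫ pullback.snd _ _ = x ≫ c.π.app j :=
  pullback.lift_snd _ _ _

theorem bcLift_isPullback {j : I} (f : j ⟶ i) :
    IsPullback (bcLift D a c h f) x (pullback.snd a (D.map f)) (c.π.app j) := by
  refine IsPullback.of_right (h₁₂ := pullback.fst a (D.map f)) (v₁₃ := a) (h₂₂ := D.map f) ?_ 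
    (bcLift_snd D a c h f) (IsPullback.of_hasPullback _ _)
  rw [bcLift_fst, c.w]
  exact h

/-- the cone over the base changed diagram -/
noncomputable def bcCone : Cone (bcF D a) :=
  mkCone _ W (fun f => bcLift D a c h f.hom) (by
    intro f f' g
    change bcLift D a c h f.hom ≫ bcMap D a g = bcLift D a c h f'.hom
    apply pullback.hom_ext
    · rw [Category.assoc, bcMap_fst, bcLift_fst, bcLift_fst]
    · rw [Category.assoc, bcMap_snd, bcLift_snd, ← Category.assoc, bcLift_snd, Category.assoc, c.w])

/-- it is a limit -/
noncomputable def bcLim [IsCofiltered I] (hc : IsLimit c) : IsLimit (bcCone D a c h) := by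
  have : CategoryTheory.IsConnected (Over i) := IsCofiltered.isConnected _
  exact isLimitOfIsPullbackOfIsConnected (bcSnd D a) (bcCone D a c h) (c.whisker (Over.forget i))
    { hom := x
      w := fun j => (bcLift_snd D a c h j.hom).symm }
    (fun j => bcLift_isPullback D a c h j.hom) 
    ((Functor.Initial.isLimitWhiskerEquiv (Over.forget i) c).symm hc)

/-- map to `A` -/
noncomputable def bcT : bcF D a ⟶ (Functor.const _).obj (D.obj i) :=
  mkConst _ _ (fun f => pullback.fst a (D.map f.hom) ≫ a) (by
    intro f f' g
    change bcMap D a g ≫ _ ≫ _ = _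
    rw [← Category.assoc, bcMap_fst]
    rfl)


theorem bcF_affine (haff : ∀ {i j : I} (f : i ⟶ j), IsAffineHom (D.map f))
    {f f' : Over i} (g : f ⟶ f') : IsAffineHom ((bcF D a).map g) := by
  have := haff g.left
  exact MorphismProperty.of_isPullback (P := @IsAffineHom) (bcMap_isPullback D a g).flip this

theorem bc_compact (haff : ∀ {i j : I} (f : i ⟶ j), IsAffineHom (D.map f))
    [CompactSpace A] {j : I} (f : j ⟶ i) : CompactSpace ↥(pullback a (D.map f)) := by
  have := haff f
  exact QuasiCompact.compactSpace_of_compactSpace (pullback.fst a (D.map f))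

theorem bc_qs (haff : ∀ {i j : I} (f : i ⟶ j), IsAffineHom (D.map f))
    [QuasiSeparatedSpace A] {j : I} (f : j ⟶ i) :
    QuasiSeparatedSpace ↥(pullback a (D.map f)) := by
  have := haff f
  exact quasiSeparatedSpace_of_quasiSeparated (pullback.fst a (D.map f))

theorem bc_exists_lift [IsCofiltered I] (haff : ∀ {i j : I} (f : i ⟶ j), IsAffineHom (D.map f))
    (hc : IsLimit c) [CompactSpace A] [QuasiSeparatedSpace A]
    {A' : Scheme.{0}} (a' : A' ⟶ D.obj i) [LocallyOfFinitePresentation a']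
    (φ : W ⟶ A') (hφ : φ ≫ a' = x ≫ c.π.app i) :
    ∃ (j : I) (f : j ⟶ i) (g : pullback a (D.map f) ⟶ A'),
      g ≫ a' = pullback.snd _ _ ≫ D.map f ∧ bcLift D a c h f ≫ g = φ := by
  have h1 : ∀ {f f' : Over i} (g : f ⟶ f'), IsAffineHom ((bcF D a).map g) := bcF_affine D a haff
  have h2 : ∀ f : Over i, CompactSpace ((bcF D a).obj f) := fun f => bc_compact D a haff f.hom
  have h3 : ∀ f : Over i, QuasiSeparatedSpace ((bcF D a).obj f) := fun f => bc_qs D a haff f.hom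
  obtain ⟨f, g, hg, hg'⟩ := Scheme.exists_π_app_comp_eq_of_locallyOfFinitePresentation (bcF D a)
    (bcT D a) a' (bcCone D a c h) (bcLim D a c h hc) φ (by
      ext f : 2
      refine Eq.trans ?_ hφ.symm
      change bcLift D a c h f.hom ≫ pullback.fst _ _ ≫ a = _
      rw [← Category.assoc, bcLift_fst, h.w])
  refine ⟨f.left, f.hom, g, ?_, hg⟩
  exact hg'.trans pullback.condition

theorem bc_exists_eq [IsCofiltered I] (haff : ∀ {i j : I} (f : i ⟶ j), IsAffineHom (D.map f))
    (h : IsPullback ω x a (c.π.app i)) (hc : IsLimit c) [CompactSpace A] [QuasiSeparatedSpace A]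
    {A' : Scheme.{0}} (a' : A' ⟶ D.obj i) [LocallyOfFiniteType a']
    (g₁ g₂ : A ⟶ A') (h₁ : g₁ ≫ a' = a) (h₂ : g₂ ≫ a' = a) (hg : ω ≫ g₁ = ω ≫ g₂) :
    ∃ (j : I) (f : j ⟶ i), pullback.fst a (D.map f) ≫ g₁ = pullback.fst a (D.map f) ≫ g₂ := by
  have h1 : ∀ {f f' : Over i} (g : f ⟶ f'), IsAffineHom ((bcF D a).map g) := bcF_affine D a haff
  have h2 : ∀ f : Over i, CompactSpace ((bcF D a).obj f) := fun f => bc_compact D a haff f.hom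
  have e₁ : pullback.fst a (D.map (𝟙 i)) ≫ a = (pullback.fst a (D.map (𝟙 i)) ≫ g₁) ≫ a' := by
    rw [Category.assoc, h₁]
  have e₂ : pullback.fst a (D.map (𝟙 i)) ≫ a = (pullback.fst a (D.map (𝟙 i)) ≫ g₂) ≫ a' := by
    rw [Category.assoc, h₂]
  have e₃ : bcLift D a c h (𝟙 i) ≫ pullback.fst a (D.map (𝟙 i)) ≫ g₁ =
      bcLift D a c h (𝟙 i) ≫ pullback.fst a (D.map (𝟙 i)) ≫ g₂ := by
    rw [← Category.assoc, ← Category.assoc, bcLift_fst, hg]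
  obtain ⟨f, k, e⟩ := Scheme.exists_hom_comp_eq_comp_of_locallyOfFiniteType (bcF D a)
    (bcT D a) a' (bcCone D a c h) (bcLim D a c h hc) (i := Over.mk (𝟙 i))
    (pullback.fst a (D.map (𝟙 i)) ≫ g₁) (pullback.fst a (D.map (𝟙 i)) ≫ g₂) e₁ e₂ e₃
  refine ⟨f.left, f.hom, ?_⟩
  have e' : bcMap D a k ≫ pullback.fst a (D.map (𝟙 i)) ≫ g₁ =
      bcMap D a k ≫ pullback.fst a (D.map (𝟙 i)) ≫ g₂ := e
  have := bcMap_fst D a k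
  rw [← Category.assoc, ← Category.assoc] at e'
  exact (congrArg (· ≫ g₁) this).symm.trans (e'.trans (congrArg (· ≫ g₂) this))

end BC

end ModelProof

namespace ModelProof
open Opposite

section Mod

variable {I : Type} [SmallCategory I] {D : I ⥤ Scheme.{0}} 

/-- `A → D i` is a model of `x : W → lim D`. -/
structure IsModel (c : Cone D) {W : Scheme.{0}} (x : W ⟶ c.pt) (i : I) {A : Scheme.{0}}
    (a : A ⟶ D.obj i) (ω : W ⟶ A) : Prop where
  lfp : LocallyOfFinitePresentation a
  cpt : CompactSpace A
  qs : QuasiSeparatedSpace A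
  pb : IsPullback ω x a (c.π.app i)

/-- `B` is a refinement of the model `A`. -/
structure Ref {W : Scheme.{0}} {i j : I} (f : j ⟶ i) {A B : Scheme.{0}}
    (a : A ⟶ D.obj i) (ω : W ⟶ A) (b : B ⟶ D.obj j) (ω' : W ⟶ B) (p : B ⟶ A) : Prop where
  pb : IsPullback p b a (D.map f)
  w : ω' ≫ p = ω

variable {c : Cone D} {W : Scheme.{0}} {x : W ⟶ c.pt} 

theorem Ref.model {i j : I} {f : j ⟶ i} {A B : Scheme.{0}}
    {a : A ⟶ D.obj i} {ω : W ⟶ A} {b : B ⟶ D.obj j} {ω' : W ⟶ B} {p : B ⟶ A}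
    (haff : ∀ {i j : I} (f : i ⟶ j), IsAffineHom (D.map f))
    (r : Ref f a ω b ω' p) (hb : ω' ≫ b = x ≫ c.π.app j) (h : IsModel c x i a ω) :
    IsModel c x j b ω' := by
  have := h.lfp
  have := h.cpt
  have := h.qs
  have := haff f
  have hp : IsAffineHom p := MorphismProperty.of_isPullback (P := @IsAffineHom) r.pb.flip this
  refine ⟨MorphismProperty.of_isPullback (P := @LocallyOfFinitePresentation) r.pb h.lfp, 
    QuasiCompact.compactSpace_of_compactSpace p, quasiSeparatedSpace_of_quasiSeparated p, ?_⟩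
  refine IsPullback.of_right (h₁₂ := p) (v₁₃ := a) (h₂₂ := D.map f) ?_ hb r.pb
  rw [r.w, c.w]
  exact h.pb

theorem Ref.comp {i j k : I} {f : j ⟶ i} {g : k ⟶ j} {A B C : Scheme.{0}}
    {a : A ⟶ D.obj i} {ω : W ⟶ A} {b : B ⟶ D.obj j} {ω' : W ⟶ B} {p : B ⟶ A}
    {d : C ⟶ D.obj k} {ω'' : W ⟶ C} {q : C ⟶ B}
    (r : Ref f a ω b ω' p) (s : Ref g b ω' d ω'' q) : Ref (g ≫ f) a ω d ω'' (q ≫ p) := by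
  refine ⟨?_, by rw [← Category.assoc, s.w, r.w]⟩
  rw [D.map_comp]
  exact s.pb.paste_horiz r.pb

theorem IsModel.bcRef {i j : I} {A : Scheme.{0}} {a : A ⟶ D.obj i} {ω : W ⟶ A}
    (h : IsModel c x i a ω) (f : j ⟶ i) : 
    Ref f a ω (pullback.snd a (D.map f)) (bcLift D a c h.pb f) (pullback.fst a (D.map f)) :=
  ⟨IsPullback.of_hasPullback _ _, bcLift_fst _ _ _ _ _⟩

theorem IsModel.bc {i j : I} {A : Scheme.{0}} {a : A ⟶ D.obj i} {ω : W ⟶ A}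
    (haff : ∀ {i j : I} (f : i ⟶ j), IsAffineHom (D.map f))
    (h : IsModel c x i a ω) (f : j ⟶ i) : 
    IsModel c x j (pullback.snd a (D.map f)) (bcLift D a c h.pb f) :=
  (h.bcRef f).model haff (bcLift_snd _ _ _ _ _) h

theorem isPullback_of_inverse {E F P P' : Scheme.{0}} {s : P ⟶ E} {s' : P' ⟶ E} (q : F ⟶ E)
    (u : P ⟶ P') (u' : P' ⟶ P) (hu : u ≫ s' = s) (hu' : u' ≫ s = s')
    (h : pullback.fst s q ≫ u ≫ u' = pullback.fst s q)
    (h' : pullback.fst s' q ≫ u' ≫ u = pullback.fst s' q) :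
    IsPullback (pullback.fst s q ≫ u) (pullback.snd s q) s' q := by
  let e : pullback s q ≅ pullback s' q :=
    { hom := pullback.lift (pullback.fst s q ≫ u) (pullback.snd s q) (by
        rw [Category.assoc, hu, pullback.condition])
      inv := pullback.lift (pullback.fst s' q ≫ u') (pullback.snd s' q) (by
        rw [Category.assoc, hu', pullback.condition])
      hom_inv_id := by
        apply pullback.hom_ext
        · rw [Category.assoc, pullback.lift_fst, ← Category.assoc, pullback.lift_fst,
            Category.assoc, h, Category.id_comp]
        · rw [Category.assoc, pullback.lift_snd, pullback.lift_snd, Category.id_comp]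
      inv_hom_id := by
        apply pullback.hom_ext
        · rw [Category.assoc, pullback.lift_fst, ← Category.assoc, pullback.lift_fst,
            Category.assoc, h', Category.id_comp]
        · rw [Category.assoc, pullback.lift_snd, pullback.lift_snd, Category.id_comp] }
  refine IsPullback.of_iso_pullback ⟨by rw [Category.assoc, hu, pullback.condition]⟩ e ?_ ?_
  · exact pullback.lift_fst _ _ _
  · exact pullback.lift_snd _ _ _

theorem exists_tr {i j j₁ : I} {A : Scheme.{0}} {a : A ⟶ D.obj i} {ω : W ⟶ A} 
    (h : IsPullback ω x a (c.π.app i)) (f : j ⟶ i) (f₁ : j₁ ⟶ i) (k : j ⟶ j₁) (hk : k ≫ f₁ = f) :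
    ∃ t : pullback a (D.map f) ⟶ pullback a (D.map f₁),
      t ≫ pullback.fst a (D.map f₁) = pullback.fst a (D.map f) ∧
      t ≫ pullback.snd a (D.map f₁) = pullback.snd a (D.map f) ≫ D.map k ∧ 
      bcLift D a c h f ≫ t = bcLift D a c h f₁ := by
  subst hk
  refine ⟨pullback.lift (pullback.fst _ _) (pullback.snd _ _ ≫ D.map k) 
    (by rw [pullback.condition, Category.assoc, D.map_comp]), pullback.lift_fst _ _ _, 
    pullback.lift_snd _ _ _, ?_⟩
  apply pullback.hom_ext
  · rw [Category.assoc, pullback.lift_fst, bcLift_fst, bcLift_fst]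
  · rw [Category.assoc, pullback.lift_snd, ← Category.assoc, bcLift_snd, bcLift_snd, 
      Category.assoc, c.w]

theorem common_ref [IsCofiltered I] (haff : ∀ {i j : I} (f : i ⟶ j), IsAffineHom (D.map f))
    (hc : IsLimit c) {i : I} {A A' : Scheme.{0}} {a : A ⟶ D.obj i} {ω : W ⟶ A}
    {a' : A' ⟶ D.obj i} {ω' : W ⟶ A'} (h : IsModel c x i a ω) (h' : IsModel c x i a' ω') :
    ∃ (k : I) (f : k ⟶ i) (B : Scheme.{0}) (b : B ⟶ D.obj k) (β : W ⟶ B) (p : B ⟶ A)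
      (p' : B ⟶ A'), IsModel c x k b β ∧ Ref f a ω b β p ∧ Ref f a' ω' b β p' := by
  have := h.lfp
  have := h.cpt
  have := h.qs
  have := h'.lfp
  have := h'.cpt
  have := h'.qs
  obtain ⟨j₁, f₁, g₁, h₁, h₁'⟩ := bc_exists_lift D a c h.pb haff hc a' ω' h'.pb.w
  obtain ⟨j₂, f₂, g₂, h₂, h₂'⟩ := bc_exists_lift D a' c h'.pb haff hc a ω h.pb.w
  obtain ⟨j, f, g, hg⟩ := exists_min' (fun b : Bool => if b then j₁ else j₂) 
    (i₀ := i) (fun b => match b with | true => f₁ | false => f₂)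
  obtain ⟨k₁, hk₁⟩ : ∃ k : j ⟶ j₁, k ≫ f₁ = f := ⟨g true, hg true⟩
  obtain ⟨k₂, hk₂⟩ : ∃ k : j ⟶ j₂, k ≫ f₂ = f := ⟨g false, hg false⟩
  have hP := h.bc haff f
  have hP' := h'.bc haff f
  have rP := h.bcRef f
  have rP' := h'.bcRef f
  obtain ⟨u, hu, hu'⟩ : ∃ u : pullback a (D.map f) ⟶ pullback a' (D.map f),
      u ≫ pullback.snd _ _ = pullback.snd _ _ ∧ 
        bcLift D a c h.pb f ≫ u = bcLift D a' c h'.pb f := by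
    obtain ⟨t, t₁, t₂, t₃⟩ := exists_tr h.pb f f₁ k₁ hk₁
    refine ⟨pullback.lift (t ≫ g₁) (pullback.snd _ _) ?_, pullback.lift_snd _ _ _, ?_⟩
    · rw [Category.assoc, h₁, ← Category.assoc, t₂, Category.assoc, ← D.map_comp, hk₁]
    · apply pullback.hom_ext
      · rw [bcLift_fst, ← h₁', Category.assoc, pullback.lift_fst, ← Category.assoc, t₃]
      · rw [Category.assoc, pullback.lift_snd, bcLift_snd, bcLift_snd]
  obtain ⟨v, hv, hv'⟩ : ∃ u : pullback a' (D.map f) ⟶ pullback a (D.map f),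
      u ≫ pullback.snd _ _ = pullback.snd _ _ ∧ 
        bcLift D a' c h'.pb f ≫ u = bcLift D a c h.pb f := by
    obtain ⟨t, t₁, t₂, t₃⟩ := exists_tr h'.pb f f₂ k₂ hk₂
    refine ⟨pullback.lift (t ≫ g₂) (pullback.snd _ _) ?_, pullback.lift_snd _ _ _, ?_⟩
    · rw [Category.assoc, h₂, ← Category.assoc, t₂, Category.assoc, ← D.map_comp, hk₂]
    · apply pullback.hom_ext
      · rw [bcLift_fst, ← h₂', Category.assoc, pullback.lift_fst, ← Category.assoc, t₃]
      · rw [Category.assoc, pullback.lift_snd, bcLift_snd, bcLift_snd]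
  generalize bcLift D a c h.pb f = α at *
  generalize bcLift D a' c h'.pb f = α' at *
  generalize pullback.fst a (D.map f) = pA at *
  generalize pullback.fst a' (D.map f) = pA' at *
  generalize pullback.snd a (D.map f) = s at *
  generalize pullback.snd a' (D.map f) = s' at *
  have := hP.lfp
  have := hP.cpt
  have := hP.qs
  have := hP'.lfp
  have := hP'.cpt
  have := hP'.qs
  obtain ⟨l₁, m₁, e₁⟩ := bc_exists_eq D s c haff hP.pb hc s (u ≫ v) (𝟙 _) 
    (by rw [Category.assoc, hv, hu]) (Category.id_comp _) 
    (by rw [← Category.assoc, hu', hv', Category.comp_id])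
  obtain ⟨l₂, m₂, e₂⟩ := bc_exists_eq D s' c haff hP'.pb hc s' (v ≫ u) (𝟙 _) 
    (by rw [Category.assoc, hu, hv]) (Category.id_comp _) 
    (by rw [← Category.assoc, hv', hu', Category.comp_id])
  obtain ⟨k, m, g, hg⟩ := exists_min' (fun b : Bool => if b then l₁ else l₂) 
    (i₀ := j) (fun b => match b with | true => m₁ | false => m₂)
  obtain ⟨n₁, hn₁⟩ : ∃ n : k ⟶ l₁, n ≫ m₁ = m := ⟨g true, hg true⟩
  obtain ⟨n₂, hn₂⟩ : ∃ n : k ⟶ l₂, n ≫ m₂ = m := ⟨g false, hg false⟩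
  have E₁ : pullback.fst s (D.map m) ≫ u ≫ v = pullback.fst s (D.map m) := by
    obtain ⟨t, t₁, -, -⟩ := exists_tr hP.pb m m₁ n₁ hn₁
    rw [← t₁, Category.assoc, e₁, Category.comp_id]
  have E₂ : pullback.fst s' (D.map m) ≫ v ≫ u = pullback.fst s' (D.map m) := by
    obtain ⟨t, t₁, -, -⟩ := exists_tr hP'.pb m m₂ n₂ hn₂
    rw [← t₁, Category.assoc, e₂, Category.comp_id]
  have key := isPullback_of_inverse (D.map m) u v hu hv E₁ E₂
  exact ⟨k, m ≫ f, _, _, _, _, _, hP.bc haff m, rP.comp (hP.bcRef m), rP'.comp 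
    ⟨key, by rw [← Category.assoc, bcLift_fst, hu']⟩⟩

end Mod

end ModelProof

namespace ModelProof
open Opposite

section Mod

variable {I : Type} [SmallCategory I] {D : I ⥤ Scheme.{0}} 

/-- a model of `S` and of an open `W` of it -/
structure IsPair (c : Cone D) {S W : Scheme.{0}} (s : S ⟶ c.pt) (w : W ⟶ S) (i : I)
    {A O : Scheme.{0}} (a : A ⟶ D.obj i) (α : S ⟶ A) (b : O ⟶ D.obj i) (ω : W ⟶ O) 
    (o : O ⟶ A) : Prop where
  m : IsModel c s i a α
  n : IsModel c (w ≫ s) i b ω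
  oi : IsOpenImmersion o
  ob : o ≫ a = b
  oo : ω ≫ o = w ≫ α

variable {c : Cone D} {S W : Scheme.{0}} {s : S ⟶ c.pt} {w : W ⟶ S}

theorem IsModel.sub [IsCofiltered I] (haff : ∀ {i j : I} (f : i ⟶ j), IsAffineHom (D.map f))
    (hc : IsLimit c) {i : I} {A : Scheme.{0}} {a : A ⟶ D.obj i} {α : S ⟶ A}
    (h : IsModel c s i a α) (w : W ⟶ S) [IsOpenImmersion w] [CompactSpace W] :
    ∃ (j : I) (_ : j ⟶ i) (A' O : Scheme.{0}) (a' : A' ⟶ D.obj j) (α' : S ⟶ A') 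
      (b : O ⟶ D.obj j) (ω : W ⟶ O) (o : O ⟶ A'), IsPair c s w j a' α' b ω o := by
  have h1 : ∀ {f f' : Over i} (g : f ⟶ f'), IsAffineHom ((bcF D a).map g) := bcF_affine D a haff
  have hW : IsCompact (w.opensRange : Set S) := by
    rw [Scheme.Hom.coe_opensRange]
    exact isCompact_range w.continuous
  obtain ⟨j, V, hV, e⟩ := exists_preimage_eq (bcF D a) (bcCone D a c h.pb) (bcLim D a c h.pb hc) 
    w.opensRange hW
  have hm := h.bc haff j.hom
  have := hm.lfp
  have := hm.cpt
  have := hm.qs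
  have e' : bcLift D a c h.pb j.hom ⁻¹ᵁ (show (pullback a (D.map j.hom)).Opens from V) = 
    w.opensRange := e
  obtain ⟨V, rfl⟩ : ∃ V' : (pullback a (D.map j.hom)).Opens, V' = V := ⟨V, rfl⟩
  have hV : IsCompact (V : Set (pullback a (D.map j.hom)).carrier) := hV
  change bcLift D a c h.pb j.hom ⁻¹ᵁ V = w.opensRange at e'
  have hle : Set.range (w ≫ bcLift D a c h.pb j.hom) ⊆ Set.range V.ι := by
    rintro _ ⟨t, rfl⟩
    rw [Scheme.Opens.range_ι]
    have : w t ∈ bcLift D a c h.pb j.hom ⁻¹ᵁ V := by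
      rw [e']
      exact ⟨t, rfl⟩
    simpa using this
  have hl : IsOpenImmersion.lift V.ι (w ≫ bcLift D a c h.pb j.hom) hle ≫ V.ι = 
      w ≫ bcLift D a c h.pb j.hom := IsOpenImmersion.lift_fac _ _ _
  have hpb : IsPullback (IsOpenImmersion.lift V.ι (w ≫ bcLift D a c h.pb j.hom) hle) w V.ι
      (bcLift D a c h.pb j.hom) := by
    apply IsOpenImmersion.isPullback 
    · exact hl.symm
    · rw [Scheme.Opens.opensRange_ι, e']
  refine ⟨j.left, j.hom, _, V, pullback.snd a (D.map j.hom), bcLift D a c h.pb j.hom, V.ι ≫ pullback.snd _ _, 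
    IsOpenImmersion.lift V.ι (w ≫ bcLift D a c h.pb j.hom) hle, V.ι, ?_⟩
  refine ⟨hm, ⟨inferInstance, isCompact_iff_compactSpace.mp hV, 
    QuasiSeparatedSpace.of_isOpenEmbedding V.ι.isOpenEmbedding, hpb.paste_vert hm.pb⟩, 
    inferInstance, rfl, hl⟩

theorem IsPair.ref (haff : ∀ {i j : I} (f : i ⟶ j), IsAffineHom (D.map f))
    {i j : I} {A O : Scheme.{0}} {a : A ⟶ D.obj i} {α : S ⟶ A} {b : O ⟶ D.obj i} {ω : W ⟶ O}
    {o : O ⟶ A} (h : IsPair c s w i a α b ω o) (f : j ⟶ i) {O' : Scheme.{0}}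
    {b' : O' ⟶ D.obj j} {ω' : W ⟶ O'} {p : O' ⟶ O} (hb : ω' ≫ b' = (w ≫ s) ≫ c.π.app j)
    (r : Ref f b ω b' ω' p) : 
    ∃ (A' : Scheme.{0}) (a' : A' ⟶ D.obj j) (α' : S ⟶ A') (o' : O' ⟶ A'), 
      IsPair c s w j a' α' b' ω' o' := by
  have := h.oi
  have e : (p ≫ o) ≫ a = b' ≫ D.map f := by
    rw [Category.assoc, h.ob, r.pb.w]
  refine ⟨_, _, _, pullback.lift (p ≫ o) b' e, h.m.bc haff f, 
    r.model haff hb h.n, ?_, pullback.lift_snd _ _ _, ?_⟩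
  · have : IsPullback p (pullback.lift (p ≫ o) b' e) o (pullback.fst a (D.map f)) := by
      refine IsPullback.of_bot (h₃₁ := D.map f) (v₂₁ := pullback.snd _ _) (v₂₂ := a) ?_ ?_ ?_
      · rw [pullback.lift_snd, h.ob]
        exact r.pb
      · rw [pullback.lift_fst]
      · exact IsPullback.of_hasPullback _ _
    exact MorphismProperty.of_isPullback (P := @IsOpenImmersion) this inferInstance
  · apply pullback.hom_ext
    · rw [Category.assoc, Category.assoc, pullback.lift_fst, bcLift_fst, ← Category.assoc, r.w, h.oo]
    · rw [Category.assoc, Category.assoc, pullback.lift_snd, bcLift_snd, hb, Category.assoc]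

theorem IsPair.bc (haff : ∀ {i j : I} (f : i ⟶ j), IsAffineHom (D.map f))
    {i j : I} {A O : Scheme.{0}} {a : A ⟶ D.obj i} {α : S ⟶ A} {b : O ⟶ D.obj i} {ω : W ⟶ O}
    {o : O ⟶ A} (h : IsPair c s w i a α b ω o) (f : j ⟶ i) : 
    ∃ (A' : Scheme.{0}) (a' : A' ⟶ D.obj j) (α' : S ⟶ A') (O' : Scheme.{0}) (b' : O' ⟶ D.obj j)
      (ω' : W ⟶ O') (o' : O' ⟶ A'), IsPair c s w j a' α' b' ω' o' := by
  obtain ⟨A, a, α, o, p⟩ := h.ref haff f (bcLift_snd _ _ _ _ _) (h.n.bcRef f)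
  exact ⟨A, a, α, _, _, _, o, p⟩

theorem IsPair.isPullback  
    {i : I} {A O : Scheme.{0}} {a : A ⟶ D.obj i} {α : S ⟶ A} {b : O ⟶ D.obj i} {ω : W ⟶ O}
    {o : O ⟶ A} (h : IsPair c s w i a α b ω o) : IsPullback ω w o α := by
  refine IsPullback.of_bot (h₃₁ := c.π.app i) (v₂₁ := s) (v₂₂ := a) ?_ h.oo h.m.pb
  rw [h.ob]
  exact h.n.pb

/-- `x` can be spread out -/
def Spr (c : Cone D) {W : Scheme.{0}} (x : W ⟶ c.pt) : Prop :=
  ∃ (i : I) (A : Scheme.{0}) (a : A ⟶ D.obj i) (ω : W ⟶ A), IsModel c x i a ω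

theorem spr_glue [IsCofiltered I] (haff : ∀ {i j : I} (f : i ⟶ j), IsAffineHom (D.map f))
    (hc : IsLimit c) {U P : Scheme.{0}} {w' : W ⟶ U} {j₁ : S ⟶ P} {j₂ : U ⟶ P} 
    (G : IsGlue w w' j₁ j₂) [CompactSpace W] [IsOpenImmersion w] [IsOpenImmersion w']
    (x : P ⟶ c.pt) (hS : Spr c (j₁ ≫ x)) (hU : Spr c (j₂ ≫ x)) : Spr c x := by
  obtain ⟨i₁, A, a, α, hA⟩ := hS
  obtain ⟨i₁', A', a', α', hA'⟩ := hU
  obtain ⟨i₂, -, A, O, a, α, b, ω, o, p⟩ := hA.sub haff hc w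
  obtain ⟨i₂', -, A', O', a', α', b', ω', o', p'⟩ := hA'.sub haff hc w'
  obtain ⟨i, ⟨g⟩⟩ := exists_min (fun b : Bool => if b then i₂ else i₂')
  obtain ⟨g₁⟩ : Nonempty (i ⟶ i₂) := ⟨g true⟩
  obtain ⟨g₂⟩ : Nonempty (i ⟶ i₂') := ⟨g false⟩
  obtain ⟨A, a, α, O, b, ω, o, p⟩ := p.bc haff g₁
  obtain ⟨A', a', α', O', b', ω', o', p'⟩ := p'.bc haff g₂
  have hx : w ≫ j₁ ≫ x = w' ≫ j₂ ≫ x := by rw [← Category.assoc, ← Category.assoc, G.pb.w]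
  have pn' := p'.n
  have pn := p.n
  rw [← hx] at pn'
  obtain ⟨k, f, B, b, β, q, q', hB, r, r'⟩ := common_ref haff hc pn pn'
  obtain ⟨A, a, α, o, p⟩ := p.ref haff f hB.pb.w r
  obtain ⟨A', a', α', o', p'⟩ := p'.ref haff f (by rw [← hx]; exact hB.pb.w) r'
  have := p.oi
  have := p'.oi
  obtain ⟨Q, m₁, m₂, G'⟩ := exists_isGlue o o'
  have hoo : o ≫ a = o' ≫ a' := by rw [p.ob, p'.ob]
  obtain ⟨d, hd₁, hd₂⟩ := G'.exists_desc a a' hoo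
  have hαα : w ≫ α ≫ m₁ = w' ≫ α' ≫ m₂ := by
    rw [← Category.assoc, ← Category.assoc, ← p.oo, ← p'.oo, Category.assoc, Category.assoc, G'.pb.w]
  obtain ⟨γ, hγ₁, hγ₂⟩ := G.exists_desc (α ≫ m₁) (α' ≫ m₂) hαα
  have := p.m.cpt
  have := p.m.qs
  have := p'.m.cpt
  have := p'.m.qs
  have := p.n.cpt
  have := HasRingHomProperty.instIsZariskiLocalAtSource (P := @LocallyOfFinitePresentation)
    (Q := RingHom.FinitePresentation)
  refine ⟨k, Q, d, γ, ⟨G'.of_source @LocallyOfFinitePresentation _ ?_ ?_, G'.compactSpace, 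
    G'.quasiSeparatedSpace, ?_⟩⟩
  · rw [hd₁]; exact p.m.lfp
  · rw [hd₂]; exact p'.m.lfp
  · refine G.isPullback_base G' p.isPullback p'.isPullback hγ₁ hγ₂ ?_ ?_
    · rw [hd₁]; exact p.m.pb
    · rw [hd₂]; exact p'.m.pb

end Mod

end ModelProof

namespace ModelProof
open Opposite

theorem isPullback_resLE_of_eq {Y Z : Scheme.{0}} (g : Y ⟶ Z) (V : Z.Opens) (U : Y.Opens)
    (h : U = g ⁻¹ᵁ V) (e : U ≤ g ⁻¹ᵁ V) : IsPullback (g.resLE V U e) U.ι V.ι g := by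
  refine IsOpenImmersion.isPullback _ _ _ _ (Scheme.Hom.resLE_comp_ι _ _).symm ?_
  rw [Scheme.Opens.opensRange_ι, Scheme.Opens.opensRange_ι, h]


theorem exists_descent {R R' : Type} [CommRing R] [CommRing R'] (φ : R →+* R')
    (hφ : φ.FinitePresentation) : ∃ s : Set R, s.Finite ∧ 
    ∀ (R₀ : Type) [CommRing R₀] (ψ : R₀ →+* R), s ⊆ Set.range ψ → 
      ∃ (M : CommRingCat.{0}) (φ₀ : CommRingCat.of R₀ ⟶ M) (τ : M ⟶ CommRingCat.of R'), 
        φ₀.hom.FinitePresentation ∧ 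
          IsPushout (CommRingCat.ofHom ψ) φ₀ (CommRingCat.ofHom φ) τ := by
  algebraize [φ]
  obtain ⟨n, m, ⟨P⟩⟩ := Algebra.Presentation.exists_presentation_fin R R'
  refine ⟨P.coeffs, P.finite_coeffs, ?_⟩
  intro R₀ _ ψ hψ
  let := ψ.toAlgebra
  let := (φ.comp ψ).toAlgebra
  have : IsScalarTower R₀ R R' := .of_algebraMap_eq' rfl
  have : P.HasCoeffs R₀ := ⟨hψ⟩
  let e := P.tensorModelOfHasCoeffsEquiv R₀
  refine ⟨CommRingCat.of (P.ModelOfHasCoeffs R₀), CommRingCat.ofHom (algebraMap _ _), 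
    CommRingCat.ofHom (e.toRingEquiv.toRingHom.comp 
      (Algebra.TensorProduct.includeRight (R := R₀) (A := R)).toRingHom), ?_, ?_⟩
  · have : Algebra.FinitePresentation R₀ (P.ModelOfHasCoeffs R₀) := inferInstance
    exact RingHom.finitePresentation_algebraMap.mpr this
  · refine (CommRingCat.isPushout_tensorProduct R₀ R (P.ModelOfHasCoeffs R₀)).of_iso (Iso.refl _)
      (Iso.refl _) (Iso.refl _) (e.toRingEquiv.toCommRingCatIso) ?_ ?_ ?_ ?_
    · simp
    · simp
    · ext r
      exact e.commutes r
    · simp; rfl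

theorem affine_model {J : Type} [SmallCategory J] [IsCofiltered J] (D : J ⥤ Scheme.{0})
    [∀ j, IsAffine (D.obj j)] (c : Cone D) (hc : IsLimit c) {U : Scheme.{0}} [IsAffine U]
    (u : U ⟶ c.pt) [LocallyOfFinitePresentation u] : ∃ (j : J) (A : Scheme.{0}) (a : A ⟶ D.obj j)
      (ω : U ⟶ A), IsModel c u j a ω := by
  have : IsAffine c.pt := Scheme.isAffine_of_isLimit _ hc
  have hu : u.appTop.hom.FinitePresentation := 
    (HasRingHomProperty.iff_of_isAffine (P := @LocallyOfFinitePresentation)).mp inferInstance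
  obtain ⟨s, hs, H⟩ := exists_descent u.appTop.hom hu
  have : Finite s := hs
  choose j t ht using fun x : s => exists_appTop_π_eq_of_isAffine_of_isLimit D c hc x.1
  obtain ⟨k, ⟨g⟩⟩ := exists_min j
  obtain ⟨M, φ₀, τ, h₁, h₂⟩ := H Γ(D.obj k, ⊤) (c.π.app k).appTop.hom (by
    intro x hx
    refine ⟨(D.map (g ⟨x, hx⟩)).appTop (t ⟨x, hx⟩), ?_⟩
    have := ht ⟨x, hx⟩
    rw [← c.w (g ⟨x, hx⟩), Scheme.Hom.comp_appTop] at this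
    exact this)
  have h₃ := isPullback_SpecMap_of_isPushout _ _ _ _ h₂
  have h₄ : LocallyOfFinitePresentation (Spec.map φ₀) := 
    (HasRingHomProperty.Spec_iff (P := @LocallyOfFinitePresentation)).mpr h₁
  refine ⟨k, Spec M, Spec.map φ₀ ≫ (D.obj k).isoSpec.inv, U.isoSpec.hom ≫ Spec.map τ, 
    inferInstance, inferInstance, inferInstance, ?_⟩
  refine h₃.flip.of_iso' U.isoSpec (Iso.refl _) c.pt.isoSpec (D.obj k).isoSpec ?_ ?_ ?_ ?_
  · simp
  · exact Scheme.isoSpec_hom_naturality u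
  · simp
  · exact Scheme.isoSpec_hom_naturality (X := c.pt) (c.π.app k)

theorem spr_affine {I : Type} [SmallCategory I] [IsCofiltered I] (D : I ⥤ Scheme.{0}) 
    (haff : ∀ {i j : I} (f : i ⟶ j), IsAffineHom (D.map f))
    (c : Cone D) (hc : IsLimit c) {U : Scheme.{0}} [IsAffine U]
    (x : U ⟶ c.pt) [LocallyOfFinitePresentation x] {i : I} (V : (D.obj i).Opens)
    (hV : IsAffineOpen V) (hx : Set.range x ⊆ ((c.π.app i ⁻¹ᵁ V : c.pt.Opens) : Set c.pt)) : Spr c x := by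
  have (j : Over i) : IsAffine ((opensDiagram D i V).obj j) := by
    have := haff j.hom
    exact hV.preimage (D.map _)
  have hx' : Set.range x ⊆ Set.range (c.π.app i ⁻¹ᵁ V).ι := by
    rwa [Scheme.Opens.range_ι]
  obtain ⟨u, hu⟩ : ∃ u : U ⟶ (c.π.app i ⁻¹ᵁ V), u ≫ (c.π.app i ⁻¹ᵁ V).ι = x := 
    ⟨IsOpenImmersion.lift _ x hx', IsOpenImmersion.lift_fac _ _ _⟩
  have hul : LocallyOfFinitePresentation u := by
    have : IsPullback (𝟙 U) u x (c.π.app i ⁻¹ᵁ V).ι := by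
      refine (IsOpenImmersion.isPullback _ _ _ _ ?_ ?_).flip
      · simp [hu]
      · rw [Scheme.Opens.opensRange_ι]
        ext t
        simpa using hx ⟨t, rfl⟩
    exact MorphismProperty.of_isPullback (P := @LocallyOfFinitePresentation) this inferInstance
  have hul' : LocallyOfFinitePresentation (Y := (opensCone D c i V).pt) u := hul
  obtain ⟨j, A, a, ω, h⟩ := affine_model (opensDiagram D i V) (opensCone D c i V) 
    (isLimitOpensCone D c hc i V) (u := u)
  have := h.lfp
  have hp : IsPullback ((opensCone D c i V).π.app j) (c.π.app i ⁻¹ᵁ V).ι 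
      (D.map j.hom ⁻¹ᵁ V).ι (c.π.app j.left) := by
    exact isPullback_resLE_of_eq (c.π.app j.left) _ _ (by rw [← c.w j.hom]; rfl) _
  have hp2 : IsPullback ω (u ≫ (c.π.app i ⁻¹ᵁ V).ι) (a ≫ (D.map j.hom ⁻¹ᵁ V).ι) (c.π.app j.left) := h.pb.paste_vert hp
  rw [hu] at hp2
  refine ⟨j.left, A, a ≫ (D.map j.hom ⁻¹ᵁ V).ι, ω, ⟨?_, h.cpt, h.qs, hp2⟩⟩
  have : LocallyOfFinitePresentation (D.map j.hom ⁻¹ᵁ V).ι := inferInstance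
  exact MorphismProperty.comp_mem @LocallyOfFinitePresentation _ _ h.lfp this

end ModelProof

namespace ModelProof
open Opposite

section
variable {I : Type} [SmallCategory I] [IsCofiltered I] (D : I ⥤ Scheme.{0}) 

theorem spr_of_iso {D : I ⥤ Scheme.{0}} {c : Cone D} {X X' : Scheme.{0}} (e : X ≅ X') (x : X' ⟶ c.pt)
    (h : Spr c (e.hom ≫ x)) : Spr c x := by
  obtain ⟨i, A, a, ω, h⟩ := h
  refine ⟨i, A, a, e.inv ≫ ω, h.lfp, h.cpt, h.qs, ?_⟩
  refine h.pb.of_iso e (Iso.refl _) (Iso.refl _) (Iso.refl _) ?_ ?_ ?_ ?_ <;> simp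

theorem spr_all (haff : ∀ {i j : I} (f : i ⟶ j), IsAffineHom (D.map f))
    (c : Cone D) (hc : IsLimit c) {X : Scheme.{0}} [CompactSpace X] [QuasiSeparatedSpace X]
    (x : X ⟶ c.pt) [LocallyOfFinitePresentation x] : Spr c x := by
  have hb : TopologicalSpace.Opens.IsBasis {U : X.Opens | IsAffineOpen U ∧ ∃ (i : I) 
      (V : (D.obj i).Opens), IsAffineOpen V ∧ U ≤ x ⁻¹ᵁ (c.π.app i ⁻¹ᵁ V : c.pt.Opens)} := by
    refine TopologicalSpace.Opens.isBasis_iff_nbhd.mpr fun {U t} htU ↦ ?_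
    obtain ⟨_, ⟨i, V, hV, rfl⟩, h₁, -⟩ := TopologicalSpace.Opens.isBasis_iff_nbhd.mp 
      (isBasis_preimage_isAffineOpen D c hc) (x := x t) (U := ⊤) trivial
    obtain ⟨U', hU', h₂, h₃⟩ := TopologicalSpace.Opens.isBasis_iff_nbhd.mp 
      X.isBasis_affineOpens (x := t) (U := U ⊓ x ⁻¹ᵁ (c.π.app i ⁻¹ᵁ V : c.pt.Opens)) ⟨htU, h₁⟩
    exact ⟨U', ⟨hU', i, V, hV, h₃.trans inf_le_right⟩, h₂, h₃.trans inf_le_left⟩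
  have key : ∀ U : X.Opens, (IsAffineOpen U ∧ ∃ (i : I) 
      (V : (D.obj i).Opens), IsAffineOpen V ∧ U ≤ x ⁻¹ᵁ (c.π.app i ⁻¹ᵁ V : c.pt.Opens)) → 
      Spr c (U.ι ≫ x) := by
    rintro U ⟨hU, i, V, hV, h⟩
    have : IsAffine U := hU
    refine spr_affine D haff c hc _ V hV ?_
    rintro _ ⟨t, rfl⟩
    exact h t.2
  obtain ⟨s, hs, hsf, e⟩ := hb.exists_finite_of_isCompact (U := ⊤) (by simpa using isCompact_univ)
  have main : ∀ s : Set X.Opens, s.Finite → (∀ U ∈ s, IsAffineOpen U ∧ ∃ (i : I) 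
      (V : (D.obj i).Opens), IsAffineOpen V ∧ U ≤ x ⁻¹ᵁ (c.π.app i ⁻¹ᵁ V : c.pt.Opens)) → 
      IsCompact ((sSup s : X.Opens) : Set X) ∧ Spr c ((sSup s : X.Opens).ι ≫ x) := by
    intro s hs
    induction s, hs using Set.Finite.induction_on with
    | empty =>
      intro _
      rw [sSup_empty]
      refine ⟨by simp, key ⊥ ⟨isAffineOpen_bot _, ?_⟩⟩
      obtain ⟨i⟩ := IsCofiltered.nonempty (C := I)
      exact ⟨i, ⊥, isAffineOpen_bot _, bot_le⟩
    | @insert U s _ _ ih =>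
      intro h
      obtain ⟨h₁, h₂⟩ := ih fun U hU => h U (Set.mem_insert_of_mem _ hU)
      have hU := h U (Set.mem_insert _ _)
      have h₃ := key U hU
      rw [sSup_insert]
      generalize sSup s = T at *
      have hcU := hU.1.isCompact
      refine ⟨by simpa using hcU.union h₁, ?_⟩
      have : CompactSpace ↥(U ⊓ T).toScheme := isCompact_iff_compactSpace.mp 
        (QuasiSeparatedSpace.inter_isCompact _ _ U.2 hcU T.2 h₁)
      refine spr_glue haff hc (isGlue_opens_sup U T) _ ?_ ?_
      · simpa using h₃
      · simpa using h₂
  have hf := (main s hsf hs).2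
  rw [← e] at hf
  exact spr_of_iso X.topIso _ hf

end

end ModelProof

namespace ModelProof
open Opposite

/-- The conclusion in terms of pullback squares. -/
def HasModel {B S X Y : Scheme.{0}} (f : S ⟶ B) (x : X ⟶ S) (y : Y ⟶ S) : Prop :=
  ∃ (A S_A X_A Y_A : Scheme.{0}) (a : A ⟶ Spec (CommRingCat.of ℤ)) (g : B ⟶ A)
    (p : S_A ⟶ A) (xA : X_A ⟶ S_A) (yA : Y_A ⟶ S_A) (σ : S ⟶ S_A) (ξ : X ⟶ X_A) (η : Y ⟶ Y_A),
    (LocallyOfFiniteType a ∧ QuasiCompact a) ∧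
    (LocallyOfFiniteType p ∧ QuasiCompact p) ∧
    (LocallyOfFiniteType xA ∧ QuasiCompact xA) ∧
    (LocallyOfFiniteType yA ∧ QuasiCompact yA) ∧
    IsPullback σ f p g ∧ IsPullback ξ x xA σ ∧ IsPullback η y yA σ

theorem HasModel.bc {B S X Y B' S' X' Y' : Scheme.{0}} {f : S ⟶ B} {x : X ⟶ S} {y : Y ⟶ S}
    {f' : S' ⟶ B'} {x' : X' ⟶ S'} {y' : Y' ⟶ S'} {β : B ⟶ B'} {σ : S ⟶ S'} {ξ : X ⟶ X'}
    {η : Y ⟶ Y'} (h : HasModel f' x' y') (h₁ : IsPullback σ f f' β) (h₂ : IsPullback ξ x x' σ)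
    (h₃ : IsPullback η y y' σ) : HasModel f x y := by
  obtain ⟨A, S_A, X_A, Y_A, a, g, p, xA, yA, σ', ξ', η', ha, hp, hx, hy, q₁, q₂, q₃⟩ := h
  exact ⟨A, S_A, X_A, Y_A, a, β ≫ g, p, xA, yA, σ ≫ σ', ξ ≫ ξ', η ≫ η', ha, hp, hx, hy,
    h₁.paste_horiz q₁, h₂.paste_horiz q₂, h₃.paste_horiz q₃⟩

theorem qc_of_spaces {S B : Scheme.{0}} (f : S ⟶ B) (h : CompactSpace S)
    (h' : QuasiSeparatedSpace B) : QuasiCompact f := by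
  have : QuasiSeparated (terminal.from B) := inferInstance
  have : QuasiCompact (f ≫ terminal.from B) := inferInstance
  exact QuasiCompact.of_comp f (terminal.from B)

theorem hasModel_of_good {B : Scheme.{0}} (hB : Good B) : ∀ {S X Y : Scheme.{0}} (f : S ⟶ B)
    (x : X ⟶ S) (y : Y ⟶ S), LocallyOfFinitePresentation f → LocallyOfFinitePresentation x →
    LocallyOfFinitePresentation y → CompactSpace S → QuasiSeparatedSpace S → CompactSpace X →
    QuasiSeparatedSpace X → CompactSpace Y → QuasiSeparatedSpace Y → HasModel f x y := by
  induction hB with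
  | ofFT B a h₁ h₂ =>
    intro S X Y f x y hf hx hy hS hS' hX hX' hY hY'
    obtain ⟨_, hq⟩ := (Good.ofFT B a h₁ h₂).compact_qs
    exact ⟨B, S, X, Y, a, 𝟙 B, f, x, y, 𝟙 S, 𝟙 X, 𝟙 Y, ⟨h₁, h₂⟩,
      ⟨inferInstance, qc_of_spaces _ hS hq⟩, ⟨inferInstance, qc_of_spaces _ hX hS'⟩,
      ⟨inferInstance, qc_of_spaces _ hY hS'⟩, IsPullback.of_id_fst, IsPullback.of_id_fst,
      IsPullback.of_id_fst⟩
  | @lim I _ _ D c hc haff hcpt hqs hg ih =>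
    intro S X Y f x y hf hx hy hS hS' hX hX' hY hY'
    obtain ⟨i, S', s', σ, hm⟩ := spr_all D haff c hc f
    have h1 : ∀ {f f' : Over i} (g : f ⟶ f'), IsAffineHom ((bcF D s').map g) :=
      bcF_affine D s' haff
    have := hm.lfp
    have := hm.cpt
    have := hm.qs
    have hx' : LocallyOfFinitePresentation (Y := (bcCone D s' c hm.pb).pt) x := hx
    have hy' : LocallyOfFinitePresentation (Y := (bcCone D s' c hm.pb).pt) y := hy
    obtain ⟨f₁, X', x', ξ, mx⟩ := spr_all (bcF D s') h1 (bcCone D s' c hm.pb)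
      (bcLim D s' c hm.pb hc) (X := X) x
    obtain ⟨f₂, Y', y', η, my⟩ := spr_all (bcF D s') h1 (bcCone D s' c hm.pb)
      (bcLim D s' c hm.pb hc) (X := Y) y
    obtain ⟨k, ⟨g⟩⟩ := exists_min (I := Over i) (fun b : Bool => if b then f₁ else f₂)
    obtain ⟨g₁⟩ : Nonempty (k ⟶ f₁) := ⟨g true⟩
    obtain ⟨g₂⟩ : Nonempty (k ⟶ f₂) := ⟨g false⟩
    have mx' := mx.bc h1 g₁
    have my' := my.bc h1 g₂
    have ms := hm.bc haff k.hom
    exact (ih k.left _ _ _ ms.lfp mx'.lfp my'.lfp ms.cpt ms.qs mx'.cpt mx'.qs my'.cpt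
      my'.qs).bc ms.pb mx'.pb my'.pb

theorem compat {A B S X S_A X_A : Scheme.{0}} {g : B ⟶ A} {p : S_A ⟶ A} {xA : X_A ⟶ S_A}
    {f : S ⟶ B} {x : X ⟶ S} {σ : S ⟶ S_A} {ξ : X ⟶ X_A} (h₁ : IsPullback σ f p g)
    (h₂ : IsPullback ξ x xA σ) :
    (h₂.flip.paste_horiz h₁.flip).flip.isoPullback.symm.hom ≫ x = 
      pullback.map (xA ≫ p) g p g xA (𝟙 B) (𝟙 A) (by simp) (by simp) ≫ h₁.isoPullback.symm.hom := by
  rw [Iso.symm_hom, Iso.symm_hom, Iso.inv_comp_eq]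
  apply h₁.hom_ext
  · rw [Category.assoc, Category.assoc, IsPullback.isoPullback_inv_fst, pullback.map,
      pullback.lift_fst, IsPullback.isoPullback_hom_fst_assoc, h₂.w]
  · rw [Category.assoc, Category.assoc, IsPullback.isoPullback_inv_snd, pullback.map,
      pullback.lift_snd, IsPullback.isoPullback_hom_snd_assoc, Category.comp_id]

end ModelProof

open ModelProof

/-- Let `B` be a noetherian scheme, `S` a finite type `B`-scheme, and `X`, `Y` finite type
`S`-schemes. Then there exist a scheme `A` of finite type over `Spec ℤ`, a morphism
`B ⟶ A`, a finite type `A`-scheme `S_A`, finite type `S_A`-schemes `X_A`, `Y_A`, and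
isomorphisms of `B`-schemes `S_A ×_A B ≅ S`, `X_A ×_A B ≅ X`, `Y_A ×_A B ≅ Y` compatible
with the structure morphisms; that is, the base change of the diagram `X_A ⟶ S_A ⟵ Y_A`
along `B ⟶ A` is isomorphic to the diagram `X ⟶ S ⟵ Y`. -/
theorem exists_model_of_diagram_over_finiteType_int
    (B S X Y : Scheme) [IsNoetherian B]
    (f : S ⟶ B) [LocallyOfFiniteType f] [QuasiCompact f]
    (x : X ⟶ S) [LocallyOfFiniteType x] [QuasiCompact x]
    (y : Y ⟶ S) [LocallyOfFiniteType y] [QuasiCompact y] :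
    ∃ (A S_A X_A Y_A : Scheme) (a : A ⟶ Spec (CommRingCat.of ℤ)) (g : B ⟶ A)
      (p : S_A ⟶ A) (xA : X_A ⟶ S_A) (yA : Y_A ⟶ S_A),
      (LocallyOfFiniteType a ∧ QuasiCompact a) ∧
      (LocallyOfFiniteType p ∧ QuasiCompact p) ∧
      (LocallyOfFiniteType xA ∧ QuasiCompact xA) ∧
      (LocallyOfFiniteType yA ∧ QuasiCompact yA) ∧
      ∃ (eS : pullback p g ≅ S) (eX : pullback (xA ≫ p) g ≅ X)
        (eY : pullback (yA ≫ p) g ≅ Y),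
        eS.hom ≫ f = pullback.snd p g ∧
        eX.hom ≫ x =
          pullback.map (xA ≫ p) g p g xA (𝟙 B) (𝟙 A) (by simp) (by simp) ≫ eS.hom ∧
        eY.hom ≫ y =
          pullback.map (yA ≫ p) g p g yA (𝟙 B) (𝟙 A) (by simp) (by simp) ≫ eS.hom := by
  have nS : IsLocallyNoetherian S := LocallyOfFiniteType.isLocallyNoetherian f
  have nX : IsLocallyNoetherian X := LocallyOfFiniteType.isLocallyNoetherian x
  have nY : IsLocallyNoetherian Y := LocallyOfFiniteType.isLocallyNoetherian y
  have cS : CompactSpace S := QuasiCompact.compactSpace_of_compactSpace f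
  have cX : CompactSpace X := QuasiCompact.compactSpace_of_compactSpace x
  have cY : CompactSpace Y := QuasiCompact.compactSpace_of_compactSpace y
  have lf : LocallyOfFinitePresentation f :=
    LocallyOfFinitePresentation.iff_locallyOfFiniteType.mpr inferInstance
  have lx : LocallyOfFinitePresentation x :=
    LocallyOfFinitePresentation.iff_locallyOfFiniteType.mpr inferInstance
  have ly : LocallyOfFinitePresentation y :=
    LocallyOfFinitePresentation.iff_locallyOfFiniteType.mpr inferInstance
  obtain ⟨A, S_A, X_A, Y_A, a, g, p, xA, yA, σ, ξ, η, ha, hp, hx, hy, q₁, q₂, q₃⟩ :=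
    hasModel_of_good (good_of_qcqs B) f x y lf lx ly cS inferInstance cX inferInstance cY
      inferInstance
  exact ⟨A, S_A, X_A, Y_A, a, g, p, xA, yA, ha, hp, hx, hy, q₁.isoPullback.symm,
    (q₂.flip.paste_horiz q₁.flip).flip.isoPullback.symm,
    (q₃.flip.paste_horiz q₁.flip).flip.isoPullback.symm, by simp, compat q₁ q₂, compat q₁ q₃⟩
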